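/- arXiv:2011.11982 — 3 statements merged into one kernel-verified Lean document; each statement's English description precedes it below -/
import Mathlib

section
/- Let ω_1,…,ω_N, σ_1,…,σ_N be weight functions satisfying condition (α) with a common constant K ≥ 1, and let Ω, Σ be the associated non-isotropic weights on ℝ^N. There exists λ_0 > 0 such that for every λ ≥ λ_0 there is a constant C_λ > 0 with the property that for all f, g ∈ S_Ω^Σ(ℝ^N): ‖e^{λΩ}(f⋆g)‖_∞ ≤ C_λ ‖e^{KλΩ} f‖_∞ · ‖e^{KλΩ} g‖_∞ and ‖e^{λΣ}(f̂⋆ĝ)‖_∞ ≤ C_λ ‖e^{KλΣ} f̂‖_∞ · ‖e^{KλΣ} ĝ‖_∞, where ⋆ denotes convolution on ℝ^N. -/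
open MeasureTheory Filter
open scoped ENNReal NNReal

noncomputable section

/-- Euclidean pairing `x·ξ = ∑ x_j ξ_j`. -/
def dotR {M : ℕ} (x ξ : Fin M → ℝ) : ℝ := ∑ j, x j * ξ j

/-- Fourier transform with kernel `e^{-i x·ξ}`. -/
def FT {M : ℕ} (f : (Fin M → ℝ) → ℂ) (ξ : Fin M → ℝ) : ℂ :=
  ∫ x, Complex.exp (-(Complex.I * (dotR x ξ : ℂ))) * f x

/-- sup-norm (in `ℝ≥0∞`) of a complex-valued function. -/
def supNorm {M : ℕ} (f : (Fin M → ℝ) → ℂ) : ℝ≥0∞ := ⨆ x, (‖f x‖₊ : ℝ≥0∞)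

/-- partial derivative `∂_j`. -/
def pD {M : ℕ} (j : Fin M) (f : (Fin M → ℝ) → ℂ) : (Fin M → ℝ) → ℂ :=
  fun x => fderiv ℝ f x (Pi.single j 1)

/-- iterated partial derivative `∂^α`. -/
def pDpow {M : ℕ} (α : Fin M → ℕ) (f : (Fin M → ℝ) → ℂ) : (Fin M → ℝ) → ℂ :=
  ((List.ofFn fun j : Fin M => (pD j)^[α j]).foldr (· ∘ ·) id) f

/-- `D^α = (-i)^{|α|} ∂^α`. -/
def Dpow {M : ℕ} (α : Fin M → ℕ) (f : (Fin M → ℝ) → ℂ) : (Fin M → ℝ) → ℂ :=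
  fun x => (-Complex.I) ^ (∑ j, α j) * pDpow α f x

/-- multiplication by the monomial `x^α`. -/
def monMul {M : ℕ} (α : Fin M → ℕ) (f : (Fin M → ℝ) → ℂ) : (Fin M → ℝ) → ℂ :=
  fun x => ((∏ j, (x j) ^ (α j) : ℝ) : ℂ) * f x

/-- Weight function in the sense of the paper (extended to `ℝ` by `ω x = ω |x|`):
continuous, increasing on `[0,∞)`, nonnegative, together with conditions
(α), (β), (γ), (δ). -/
structure IsWeightFun (ω : ℝ → ℝ) : Prop where
  nonneg : ∀ x, 0 ≤ ω x
  eq_abs : ∀ x, ω x = ω |x|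
  continuous : Continuous ω
  mono : MonotoneOn ω (Set.Ici 0)
  alphaCond : ∃ K, 1 ≤ K ∧ ∀ x, 0 ≤ x → ω (2 * x) ≤ K * (1 + ω x)
  betaCond : Filter.Tendsto (fun x => ω x / x) Filter.atTop (nhds 0)
  gammaCond : ∃ a b : ℝ, 0 < b ∧ ∀ x, 0 ≤ x → a + b * Real.log (1 + x) ≤ ω x
  deltaCond : ConvexOn ℝ (Set.Ici 0) fun t => ω (Real.exp t)

/-- non-isotropic weight `Ω(x) = ω_1(x_1) + ⋯ + ω_M(x_M)`. -/
def wSum {M : ℕ} (ω : Fin M → ℝ → ℝ) (x : Fin M → ℝ) : ℝ := ∑ j, ω j (x j)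

/-- Membership in the space `S_Ω^Σ(ℝ^M)`: `f ∈ L¹`, `f` and `f̂` smooth, and for
every `λ > 0` and every multi-index `α`, `‖e^{λΩ} D^α f‖_∞ < ∞` and
`‖e^{λΣ} D^α f̂‖_∞ < ∞`. -/
structure MemS {M : ℕ} (Om Sig : (Fin M → ℝ) → ℝ) (f : (Fin M → ℝ) → ℂ) : Prop where
  integrable : Integrable f
  smooth : ContDiff ℝ (⊤ : ℕ∞) f
  smooth_ft : ContDiff ℝ (⊤ : ℕ∞) (FT f)
  decay : ∀ lam : ℝ, 0 < lam → ∀ α : Fin M → ℕ,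
      supNorm (fun x => (Real.exp (lam * Om x) : ℂ) * Dpow α f x) < ⊤
  decay_ft : ∀ lam : ℝ, 0 < lam → ∀ α : Fin M → ℕ,
      supNorm (fun ξ => (Real.exp (lam * Sig ξ) : ℂ) * Dpow α (FT f) ξ) < ⊤

/-- convolution on `ℝ^M`. -/
def conv {M : ℕ} (f g : (Fin M → ℝ) → ℂ) (x : Fin M → ℝ) : ℂ := ∫ t, f t * g (x - t)

/-- Sharp form of subadditivity: the loss is only in the larger of the two terms. -/
theorem IsWeightFun.add_le {ω : ℝ → ℝ} (hω : IsWeightFun ω) {K : ℝ} (hK : 0 ≤ K)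
    (hα : ∀ x, 0 ≤ x → ω (2 * x) ≤ K * (1 + ω x)) (s t : ℝ) :
    ω (s + t) ≤ K * (1 + max (ω s) (ω t)) := by
  have key : ω (s + t) ≤ ω (2 * max |s| |t|) := by
    rw [hω.eq_abs (s + t)]
    refine hω.mono (Set.mem_Ici.2 (abs_nonneg _)) (Set.mem_Ici.2 (by positivity)) ?_
    linarith [abs_add_le s t, le_max_left |s| |t|, le_max_right |s| |t|]
  refine key.trans ((hα _ (by positivity)).trans ?_)
  gcongr
  rcases max_choice |s| |t| with h | h <;> rw [h, ← hω.eq_abs]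
  · exact le_max_left _ _
  · exact le_max_right _ _

theorem IsWeightFun.exists_integrable_exp_neg {ω : ℝ → ℝ} (hω : IsWeightFun ω) :
    ∃ l : ℝ, 0 < l ∧ ∀ lam, l ≤ lam → Integrable fun x => Real.exp (-(lam * ω x)) := by
  obtain ⟨a, b, hb, h⟩ := hω.gammaCond
  refine ⟨2 / b, by positivity, fun lam hlam => ?_⟩
  have hlam0 : 0 < lam := lt_of_lt_of_le (by positivity) hlam
  have hr : ((Module.finrank ℝ ℝ : ℕ) : ℝ) < lam * b := by
    rw [div_le_iff₀ hb] at hlam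
    simp only [Module.finrank_self, Nat.cast_one]
    linarith
  refine ((integrable_one_add_norm (μ := volume) hr).const_mul (Real.exp (-(lam * a)))).mono'
    ?_ (Eventually.of_forall fun x => ?_)
  · have := hω.continuous
    exact Continuous.aestronglyMeasurable (by fun_prop)
  · have hx : 0 < 1 + ‖x‖ := by positivity
    rw [Real.norm_of_nonneg (Real.exp_pos _).le, Real.rpow_def_of_pos hx, ← Real.exp_add,
      Real.exp_le_exp, hω.eq_abs x]
    have h1 := mul_le_mul_of_nonneg_left (h |x| (abs_nonneg x)) hlam0.le
    rw [Real.norm_eq_abs]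
    linarith

/-- The exponent is bounded through `max a b = a + b - min a b`; the factors `e^{-Kλ min}` are what
makes the convolution integral converge. -/
theorem exp_wSum_add_le {N : ℕ} {ω : Fin N → ℝ → ℝ} (hω : ∀ j, IsWeightFun (ω j)) {K : ℝ}
    (hK : 0 ≤ K) (hα : ∀ j x, 0 ≤ x → ω j (2 * x) ≤ K * (1 + ω j x)) {lam : ℝ} (hlam : 0 ≤ lam)
    (s t : Fin N → ℝ) :
    Real.exp (lam * wSum ω (s + t)) ≤ Real.exp (lam * K * N) *
      (Real.exp (K * lam * wSum ω s) * Real.exp (K * lam * wSum ω t) *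
        ∏ j, (Real.exp (-(K * lam * ω j (s j))) + Real.exp (-(K * lam * ω j (t j))))) := by
  have hN : Real.exp (lam * K * N) = ∏ _j : Fin N, Real.exp (lam * K) := by
    rw [Finset.prod_const, ← Real.exp_nat_mul, Finset.card_univ, Fintype.card_fin, mul_comm]
  simp only [wSum, Finset.mul_sum, Real.exp_sum, hN, ← Finset.prod_mul_distrib]
  refine Finset.prod_le_prod (fun _ _ => (Real.exp_pos _).le) fun j _ => ?_
  have h := mul_le_mul_of_nonneg_left ((hω j).add_le hK (hα j) (s j) (t j)) hlam
  rw [mul_add (_ * _), ← Real.exp_add, ← Real.exp_add, ← Real.exp_add, mul_add,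
    ← Real.exp_add, ← Real.exp_add, Pi.add_apply]
  rcases max_choice (ω j (s j)) (ω j (t j)) with hm | hm <;> rw [hm] at h
  · refine le_add_of_nonneg_of_le (Real.exp_pos _).le (Real.exp_le_exp.2 ?_)
    linarith
  · refine le_add_of_le_of_nonneg (Real.exp_le_exp.2 ?_) (Real.exp_pos _).le
    linarith

theorem enorm_le_supNorm {M : ℕ} (f : (Fin M → ℝ) → ℂ) (x : Fin M → ℝ) : ‖f x‖ₑ ≤ supNorm f :=
  le_iSup (fun x => (‖f x‖₊ : ℝ≥0∞)) x

theorem enorm_exp_mul (r : ℝ) (z : ℂ) :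
    ‖(Real.exp r : ℂ) * z‖ₑ = ENNReal.ofReal (Real.exp r) * ‖z‖ₑ := by
  rw [enorm_mul, ← ofReal_norm (Real.exp r : ℂ), Complex.norm_real,
    Real.norm_of_nonneg (Real.exp_pos r).le]

/-- Weighted sup-norm estimate for the convolution of arbitrary functions. -/
theorem exists_supNorm_conv_le {N : ℕ} {ω : Fin N → ℝ → ℝ} (hω : ∀ j, IsWeightFun (ω j)) {K : ℝ}
    (hK : 1 ≤ K) (hα : ∀ j x, 0 ≤ x → ω j (2 * x) ≤ K * (1 + ω j x)) :
    ∃ lam0 : ℝ, 0 < lam0 ∧ ∀ lam : ℝ, lam0 ≤ lam → ∃ C : ℝ, 0 < C ∧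
      ∀ f g : (Fin N → ℝ) → ℂ,
        supNorm (fun x => (Real.exp (lam * wSum ω x) : ℂ) * conv f g x) ≤
          ENNReal.ofReal C *
            supNorm (fun x => (Real.exp (K * lam * wSum ω x) : ℂ) * f x) *
            supNorm (fun x => (Real.exp (K * lam * wSum ω x) : ℂ) * g x) := by
  choose l hl hint using fun j => (hω j).exists_integrable_exp_neg
  have hsum : 0 ≤ ∑ j, l j := Finset.sum_nonneg fun j _ => (hl j).le
  refine ⟨1 + ∑ j, l j, by linarith, fun lam hlam => ?_⟩
  have hlam0 : 0 ≤ lam := by linarith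
  set φ : Fin N → ℝ → ℝ := fun j x => Real.exp (-(K * lam * ω j x))
  have hφi : ∀ j, Integrable (φ j) := fun j => hint j _ <| by
    have := Finset.single_le_sum (fun i _ => (hl i).le) (Finset.mem_univ j)
    nlinarith
  have hφ0 : ∀ j x, 0 ≤ φ j x := fun j x => (Real.exp_pos _).le
  set I : ℝ := ∏ j, (2 * ∫ x, φ j x)
  have hI0 : 0 ≤ I := Finset.prod_nonneg fun j _ =>
    mul_nonneg zero_le_two (integral_nonneg (hφ0 j))
  set E : ℝ := Real.exp (lam * K * N)
  have hE0 : 0 ≤ E := (Real.exp_pos _).le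
  refine ⟨E * I + 1, by positivity, fun f g => iSup_le fun x => ?_⟩
  set A := supNorm fun x => (Real.exp (K * lam * wSum ω x) : ℂ) * f x
  set B := supNorm fun x => (Real.exp (K * lam * wSum ω x) : ℂ) * g x
  set H : (Fin N → ℝ) → ℝ := fun t => ∏ j, (φ j (t j) + φ j (x j - t j)) with hH
  have hHi : Integrable H := Integrable.fintype_prod
    (f := fun j t => φ j t + φ j (x j - t)) fun j => (hφi j).add ((hφi j).comp_sub_left _)
  have hHI : ∫ t, H t = I := by
    rw [hH, integral_fintype_prod_volume_eq_prod (f := fun j t => φ j t + φ j (x j - t))]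
    refine Finset.prod_congr rfl fun j _ => ?_
    rw [integral_add (hφi j) ((hφi j).comp_sub_left _), integral_sub_left_eq_self, two_mul]
  have hH0 : ∀ t, 0 ≤ H t := fun t =>
    Finset.prod_nonneg fun j _ => add_nonneg (hφ0 _ _) (hφ0 _ _)
  have hHm : ∫⁻ t, ENNReal.ofReal (H t) = ENNReal.ofReal I := by
    rw [← hHI, ofReal_integral_eq_lintegral_ofReal hHi (Eventually.of_forall hH0)]
  have hpt : ∀ t, ENNReal.ofReal (Real.exp (lam * wSum ω x)) * ‖f t * g (x - t)‖ₑ ≤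
      ENNReal.ofReal E * A * B * ENNReal.ofReal (H t) := fun t => by
    have h := exp_wSum_add_le hω (zero_le_one.trans hK) hα hlam0 t (x - t)
    rw [add_sub_cancel] at h
    calc
      _ ≤ ENNReal.ofReal (E * (Real.exp (K * lam * wSum ω t) *
            Real.exp (K * lam * wSum ω (x - t)) * H t)) * ‖f t * g (x - t)‖ₑ := by
        gcongr
        exact h
      _ = ENNReal.ofReal E * ‖(Real.exp (K * lam * wSum ω t) : ℂ) * f t‖ₑ *
            ‖(Real.exp (K * lam * wSum ω (x - t)) : ℂ) * g (x - t)‖ₑ *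
            ENNReal.ofReal (H t) := by
        rw [enorm_exp_mul, enorm_exp_mul, enorm_mul, ENNReal.ofReal_mul hE0,
          ENNReal.ofReal_mul (by positivity), ENNReal.ofReal_mul (by positivity)]
        ring
      _ ≤ _ := by
        gcongr
        · exact enorm_le_supNorm (fun x => (Real.exp (K * lam * wSum ω x) : ℂ) * f x) t
        · exact enorm_le_supNorm (fun x => (Real.exp (K * lam * wSum ω x) : ℂ) * g x) (x - t)
  change ‖(Real.exp (lam * wSum ω x) : ℂ) * conv f g x‖ₑ ≤ _
  calc
    _ ≤ ENNReal.ofReal (Real.exp (lam * wSum ω x)) * ∫⁻ t, ‖f t * g (x - t)‖ₑ := by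
      rw [enorm_exp_mul]
      gcongr
      exact enorm_integral_le_lintegral_enorm _
    _ ≤ ∫⁻ t, ENNReal.ofReal (Real.exp (lam * wSum ω x)) * ‖f t * g (x - t)‖ₑ :=
      lintegral_const_mul_le _ _
    _ ≤ ∫⁻ t, ENNReal.ofReal E * A * B * ENNReal.ofReal (H t) := lintegral_mono hpt
    _ = ENNReal.ofReal (E * I) * A * B := by
      rw [lintegral_const_mul'' _ hHi.aemeasurable.ennreal_ofReal, hHm, ENNReal.ofReal_mul hE0]
      ring
    _ ≤ _ := by
      gcongr
      linarith

/-- Convolution estimates in `S_Ω^Σ` (Lemma 2.6 of the paper). -/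
theorem statement_1 (N : ℕ) (ω σ : Fin N → ℝ → ℝ)
    (hω : ∀ j, IsWeightFun (ω j)) (hσ : ∀ j, IsWeightFun (σ j))
    (K : ℝ) (hK : 1 ≤ K)
    (hωα : ∀ j x, 0 ≤ x → ω j (2 * x) ≤ K * (1 + ω j x))
    (hσα : ∀ j x, 0 ≤ x → σ j (2 * x) ≤ K * (1 + σ j x)) :
    ∃ lam0 : ℝ, 0 < lam0 ∧ ∀ lam : ℝ, lam0 ≤ lam → ∃ C : ℝ, 0 < C ∧
      ∀ f g : (Fin N → ℝ) → ℂ,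
        MemS (wSum ω) (wSum σ) f → MemS (wSum ω) (wSum σ) g →
        supNorm (fun x => (Real.exp (lam * wSum ω x) : ℂ) * conv f g x) ≤
          ENNReal.ofReal C *
            supNorm (fun x => (Real.exp (K * lam * wSum ω x) : ℂ) * f x) *
            supNorm (fun x => (Real.exp (K * lam * wSum ω x) : ℂ) * g x) ∧
        supNorm (fun ξ => (Real.exp (lam * wSum σ ξ) : ℂ) * conv (FT f) (FT g) ξ) ≤
          ENNReal.ofReal C *
            supNorm (fun ξ => (Real.exp (K * lam * wSum σ ξ) : ℂ) * FT f ξ) *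
            supNorm (fun ξ => (Real.exp (K * lam * wSum σ ξ) : ℂ) * FT g ξ) := by
  obtain ⟨l₁, hl₁, h₁⟩ := exists_supNorm_conv_le hω hK hωα
  obtain ⟨l₂, -, h₂⟩ := exists_supNorm_conv_le hσ hK hσα
  refine ⟨max l₁ l₂, lt_max_of_lt_left hl₁, fun lam hlam => ?_⟩
  obtain ⟨C₁, hC₁, h₁⟩ := h₁ lam ((le_max_left _ _).trans hlam)
  obtain ⟨C₂, -, h₂⟩ := h₂ lam ((le_max_right _ _).trans hlam)
  refine ⟨max C₁ C₂, lt_max_of_lt_left hC₁, fun f g _ _ =>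
    ⟨(h₁ f g).trans ?_, (h₂ (FT f) (FT g)).trans ?_⟩⟩
  · gcongr
    exact le_max_left _ _
  · gcongr
    exact le_max_right _ _

end
end

section
/- Let Ω, Σ be non-isotropic weights on ℝ^N built from weight functions, let g ∈ S_Ω^Σ(ℝ^N), and let F : ℝ^{2N} → ℂ be measurable such that for each λ > 0 there exists C_λ > 0 with |F(x,ξ)| ≤ C_λ e^{−λ(Ω(x)+Σ(ξ))} for all (x,ξ) ∈ ℝ^{2N}. Then the integral f(t) := ∫_{ℝ^{2N}} F(x,ξ) e^{i t·ξ} g(t−x) dx dξ converges absolutely and defines a function f ∈ S_Ω^Σ(ℝ^N). -/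
open MeasureTheory Filter
open scoped ENNReal NNReal

noncomputable section

/-- translation operator `T_s f(t) = f(t - s)`. -/
def Tr {M : ℕ} (s : Fin M → ℝ) (f : (Fin M → ℝ) → ℂ) : (Fin M → ℝ) → ℂ := fun t => f (t - s)

/-- modulation operator `M_ξ f(t) = e^{i t·ξ} f(t)`. -/
def Mod' {M : ℕ} (ξ : Fin M → ℝ) (f : (Fin M → ℝ) → ℂ) : (Fin M → ℝ) → ℂ :=
  fun t => Complex.exp (Complex.I * (dotR t ξ : ℂ)) * f t

section

variable {N : ℕ}

lemma fderiv_eq_sum_smulRight_pD (f : (Fin N → ℝ) → ℂ) (x : Fin N → ℝ) :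
    fderiv ℝ f x = ∑ j, (ContinuousLinearMap.proj (R := ℝ) (φ := fun _ : Fin N => ℝ) j).smulRight
      (pD j f x) := by
  ext v
  conv_lhs => rw [pi_eq_sum_univ' v]
  simp [map_sum, pD]

lemma norm_fderiv_le_sum_norm_pD (f : (Fin N → ℝ) → ℂ) (x : Fin N → ℝ) :
    ‖fderiv ℝ f x‖ ≤ ∑ j, ‖pD j f x‖ := by
  rw [fderiv_eq_sum_smulRight_pD]
  refine (norm_sum_le _ _).trans (Finset.sum_le_sum fun j _ => ?_)
  refine ContinuousLinearMap.opNorm_le_bound _ (norm_nonneg _) fun v => ?_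
  rw [ContinuousLinearMap.smulRight_apply, norm_smul, mul_comm]
  exact mul_le_mul_of_nonneg_left (norm_le_pi_norm v j) (norm_nonneg _)

lemma contDiff_pD {f : (Fin N → ℝ) → ℂ} (hf : ContDiff ℝ (⊤ : ℕ∞) f) (j : Fin N) :
    ContDiff ℝ (⊤ : ℕ∞) (pD j f) :=
  (hf.fderiv_right (m := (⊤ : ℕ∞)) (by simp)).clm_apply contDiff_const

lemma pD_comm {f : (Fin N → ℝ) → ℂ} (hf : ContDiff ℝ (⊤ : ℕ∞) f) (j k : Fin N) :
    pD j (pD k f) = pD k (pD j f) := by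
  have hd : Differentiable ℝ (fderiv ℝ f) :=
    (hf.fderiv_right (m := (⊤ : ℕ∞)) (by simp)).differentiable (by simp)
  have key : ∀ (a b : Fin N) (x : Fin N → ℝ), pD a (pD b f) x =
      fderiv ℝ (fderiv ℝ f) x (Pi.single a 1) (Pi.single b 1) := by
    intro a b x
    change fderiv ℝ (fun y => fderiv ℝ f y (Pi.single b 1)) x (Pi.single a 1) = _
    rw [fderiv_clm_apply (hd x) (differentiableAt_const _)]
    simp
  ext x
  rw [key, key]
  exact (hf.of_le (m := 2) (WithTop.coe_le_coe.2 le_top)).contDiffAt.isSymmSndFDerivAt (by simp) _ _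

lemma contDiff_iterate_pD {f : (Fin N → ℝ) → ℂ} (hf : ContDiff ℝ (⊤ : ℕ∞) f) (j : Fin N) (n : ℕ) :
    ContDiff ℝ (⊤ : ℕ∞) ((pD j)^[n] f) := by
  induction n with
  | zero => exact hf
  | succ n ih => rw [Function.iterate_succ_apply']; exact contDiff_pD ih j

lemma pD_iterate_comm {f : (Fin N → ℝ) → ℂ} (hf : ContDiff ℝ (⊤ : ℕ∞) f) (j k : Fin N) (n : ℕ) :
    pD j ((pD k)^[n] f) = (pD k)^[n] (pD j f) := by
  induction n with
  | zero => rfl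
  | succ n ih =>
    rw [Function.iterate_succ_apply', Function.iterate_succ_apply',
      pD_comm (contDiff_iterate_pD hf k n), ih]

/-- Iterated partial derivatives, taken successively over the indices in a list. -/
def pDlist (α : Fin N → ℕ) (l : List (Fin N)) (f : (Fin N → ℝ) → ℂ) : (Fin N → ℝ) → ℂ :=
  l.foldr (fun j h => (pD j)^[α j] h) f

lemma pDpow_eq_pDlist (α : Fin N → ℕ) (f : (Fin N → ℝ) → ℂ) :
    pDpow α f = pDlist α (List.finRange N) f := by
  unfold pDpow pDlist
  rw [List.ofFn_eq_map]
  induction List.finRange N with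
  | nil => rfl
  | cons k l ih => simp only [List.map_cons, List.foldr_cons, Function.comp_apply, ih]

lemma contDiff_pDlist {f : (Fin N → ℝ) → ℂ} (hf : ContDiff ℝ (⊤ : ℕ∞) f) (α : Fin N → ℕ)
    (l : List (Fin N)) : ContDiff ℝ (⊤ : ℕ∞) (pDlist α l f) := by
  induction l with
  | nil => exact hf
  | cons k l ih => exact contDiff_iterate_pD ih k _

lemma pDlist_pD {f : (Fin N → ℝ) → ℂ} (hf : ContDiff ℝ (⊤ : ℕ∞) f) (α : Fin N → ℕ)
    (l : List (Fin N)) (j : Fin N) : pDlist α l (pD j f) = pD j (pDlist α l f) := by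
  induction l with
  | nil => rfl
  | cons k l ih =>
    change (pD k)^[α k] (pDlist α l (pD j f)) = pD j ((pD k)^[α k] (pDlist α l f))
    rw [ih, pD_iterate_comm (contDiff_pDlist hf α l)]

lemma pDlist_update_of_notMem (α : Fin N → ℕ) (l : List (Fin N)) (j : Fin N) (n : ℕ) (hj : j ∉ l)
    (f : (Fin N → ℝ) → ℂ) : pDlist (Function.update α j n) l f = pDlist α l f := by
  induction l with
  | nil => rfl
  | cons k l ih =>
    rw [List.mem_cons, not_or] at hj
    change (pD k)^[Function.update α j n k] (pDlist _ l f) = (pD k)^[α k] (pDlist α l f)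
    rw [ih hj.2, Function.update_of_ne (Ne.symm hj.1)]

lemma pD_pDlist {f : (Fin N → ℝ) → ℂ} (hf : ContDiff ℝ (⊤ : ℕ∞) f) (α : Fin N → ℕ)
    (l : List (Fin N)) (hl : l.Nodup) (j : Fin N) (hj : j ∈ l) :
    pD j (pDlist α l f) = pDlist (Function.update α j (α j + 1)) l f := by
  induction l with
  | nil => simp at hj
  | cons k l ih =>
    rw [List.nodup_cons] at hl
    change pD j ((pD k)^[α k] (pDlist α l f)) =
      (pD k)^[Function.update α j (α j + 1) k] (pDlist (Function.update α j (α j + 1)) l f)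
    by_cases h : j = k
    · subst h
      rw [pDlist_update_of_notMem _ _ _ _ hl.1, Function.update_self, Function.iterate_succ_apply']
    · rw [pD_iterate_comm (contDiff_pDlist hf α l), Function.update_of_ne (Ne.symm h),
        ih hl.2 ((List.mem_cons.1 hj).resolve_left h)]

lemma pDpow_pD {f : (Fin N → ℝ) → ℂ} (hf : ContDiff ℝ (⊤ : ℕ∞) f) (α : Fin N → ℕ) (j : Fin N) :
    pDpow α (pD j f) = pDpow (Function.update α j (α j + 1)) f := by
  rw [pDpow_eq_pDlist, pDpow_eq_pDlist, pDlist_pD hf,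
    pD_pDlist hf _ _ (List.nodup_finRange N) j (List.mem_finRange j)]

lemma pDpow_zero (f : (Fin N → ℝ) → ℂ) : pDpow 0 f = f := by
  rw [pDpow_eq_pDlist]
  induction List.finRange N with
  | nil => rfl
  | cons k l ih => exact ih

/-- A class of functions stable under partial derivatives is stable under
iterated partial derivatives. -/
lemma pDpow_mem_of_stable {P : ((Fin N → ℝ) → ℂ) → Prop} (hP : ∀ f, P f → ∀ j, P (pD j f))
    (α : Fin N → ℕ) {f : (Fin N → ℝ) → ℂ} (hf : P f) : P (pDpow α f) := by
  have hiter : ∀ (j : Fin N) (n : ℕ) (h : (Fin N → ℝ) → ℂ), P h → P ((pD j)^[n] h) := by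
    intro j n h hh
    induction n with
    | zero => exact hh
    | succ n ih => rw [Function.iterate_succ_apply']; exact hP _ ih j
  rw [pDpow_eq_pDlist]
  induction List.finRange N with
  | nil => exact hf
  | cons k l ih => exact hiter k _ _ ih

/-- A class of differentiable functions stable under partial derivatives consists of smooth
functions. -/
lemma contDiff_of_stable {P : ((Fin N → ℝ) → ℂ) → Prop} (hP : ∀ f, P f → ∀ j, P (pD j f))
    (hd : ∀ f, P f → Differentiable ℝ f) {f : (Fin N → ℝ) → ℂ} (hf : P f) :
    ContDiff ℝ (⊤ : ℕ∞) f := by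
  rw [contDiff_infty]
  intro n
  induction n generalizing f with
  | zero => exact contDiff_zero.2 (hd f hf).continuous
  | succ n ih =>
    push_cast
    rw [contDiff_succ_iff_fderiv]
    refine ⟨hd f hf, by simp, ?_⟩
    have : fderiv ℝ f = fun x => ∑ j,
        ContinuousLinearMap.smulRightL ℝ (Fin N → ℝ) ℂ
          (ContinuousLinearMap.proj (R := ℝ) (φ := fun _ : Fin N => ℝ) j) (pD j f x) :=
      funext (fderiv_eq_sum_smulRight_pD f)
    rw [this]
    exact ContDiff.sum fun j _ => (ContinuousLinearMap.contDiff _).comp (ih (hP f hf j))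

lemma IsWeightFun.exists_le_add {ω : ℝ → ℝ} (hω : IsWeightFun ω) :
    ∃ K, 0 ≤ K ∧ ∀ x y, ω (x + y) ≤ K * (1 + ω x + ω y) := by
  obtain ⟨K, hK1, hK⟩ := hω.alphaCond
  have hK0 : 0 ≤ K := by linarith
  refine ⟨K, hK0, ?_⟩
  have key : ∀ x y, |x| ≤ |y| → ω (x + y) ≤ K * (1 + ω x + ω y) := by
    intro x y hxy
    calc ω (x + y) = ω |x + y| := hω.eq_abs _
      _ ≤ ω (2 * |y|) := hω.mono (Set.mem_Ici.2 (abs_nonneg _)) (Set.mem_Ici.2 (by positivity))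
         (by linarith [abs_add_le x y])
      _ ≤ K * (1 + ω |y|) := hK _ (abs_nonneg y)
      _ ≤ K * (1 + ω x + ω y) := by
        rw [← hω.eq_abs]
        exact mul_le_mul_of_nonneg_left (by linarith [hω.nonneg x]) hK0
  intro x y
  rcases le_total |x| |y| with h | h
  · exact key x y h
  · have := key y x h
    rwa [add_comm y x, add_right_comm] at this

lemma IsWeightFun.exists_one_add_abs_le_exp {ω : ℝ → ℝ} (hω : IsWeightFun ω) :
    ∃ c b : ℝ, 0 < c ∧ 0 < b ∧ ∀ x, 1 + |x| ≤ c * Real.exp (b * ω x) := by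
  obtain ⟨a, b, hb, h⟩ := hω.gammaCond
  refine ⟨Real.exp (-a / b), 1 / b, Real.exp_pos _, by positivity, fun x => ?_⟩
  have h1 := h |x| (abs_nonneg x)
  have hp : 0 < 1 + |x| := by positivity
  rw [← hω.eq_abs] at h1
  rw [← Real.exp_add, ← Real.log_le_iff_le_exp hp,
    show -a / b + 1 / b * ω x = (ω x - a) / b by ring, le_div_iff₀ hb]
  linarith

lemma IsWeightFun.exists_integrable {ω : ℝ → ℝ} (hω : IsWeightFun ω) :
    ∃ L, 0 < L ∧ ∀ lam, L ≤ lam → Integrable fun x => Real.exp (-(lam * ω x)) := by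
  obtain ⟨c, b, hc, hb, h⟩ := hω.exists_one_add_abs_le_exp
  refine ⟨2 * b, by positivity, fun lam hlam => ?_⟩
  have hint : Integrable fun x : ℝ => c ^ 2 * (1 + ‖x‖) ^ (-(2 : ℝ)) :=
    (integrable_one_add_norm (by simp)).const_mul _
  refine hint.mono' ?_ (ae_of_all _ fun x => ?_)
  · exact (Real.continuous_exp.comp (hω.continuous.const_mul lam).neg).aestronglyMeasurable
  · have hp : 0 < 1 + |x| := by positivity
    rw [Real.norm_of_nonneg (Real.exp_pos _).le, Real.norm_eq_abs, Real.rpow_neg hp.le,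
      ← div_eq_mul_inv, le_div_iff₀ (by positivity), Real.exp_neg, inv_mul_le_iff₀ (Real.exp_pos _)]
    calc (1 + |x|) ^ (2 : ℝ) = (1 + |x|) ^ 2 := by norm_cast
      _ ≤ (c * Real.exp (b * ω x)) ^ 2 := by gcongr; exact h x
      _ = Real.exp (2 * b * ω x) * c ^ 2 := by rw [mul_pow, ← Real.exp_nat_mul]; push_cast; ring_nf
      _ ≤ Real.exp (lam * ω x) * c ^ 2 := by
        gcongr
        exact hω.nonneg x

variable {ω σ : Fin N → ℝ → ℝ}

lemma le_wSum (hω : ∀ j, IsWeightFun (ω j)) (x : Fin N → ℝ) (j : Fin N) :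
    ω j (x j) ≤ wSum ω x :=
  Finset.single_le_sum (f := fun j => ω j (x j)) (fun i _ => (hω i).nonneg _) (Finset.mem_univ j)

lemma wSum_nonneg (hω : ∀ j, IsWeightFun (ω j)) (x : Fin N → ℝ) : 0 ≤ wSum ω x :=
  Finset.sum_nonneg fun i _ => (hω i).nonneg _

lemma wSum_neg (hω : ∀ j, IsWeightFun (ω j)) (x : Fin N → ℝ) : wSum ω (-x) = wSum ω x := by
  refine Finset.sum_congr rfl fun j _ => ?_
  rw [(hω j).eq_abs, (hω j).eq_abs (x j), Pi.neg_apply, abs_neg]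

lemma exists_wSum_add_le (hω : ∀ j, IsWeightFun (ω j)) :
    ∃ K, 0 < K ∧ ∀ x y, wSum ω (x + y) ≤ K * (1 + wSum ω x + wSum ω y) := by
  choose K hK0 hK using fun j => (hω j).exists_le_add
  refine ⟨∑ j, K j + 1, by linarith [Finset.sum_nonneg fun j (_ : j ∈ Finset.univ) => hK0 j],
    fun x y => ?_⟩
  have hx := wSum_nonneg hω x
  have hy := wSum_nonneg hω y
  calc wSum ω (x + y) ≤ ∑ j, K j * (1 + wSum ω x + wSum ω y) := by
        refine Finset.sum_le_sum fun j _ => (hK j (x j) (y j)).trans ?_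
        exact mul_le_mul_of_nonneg_left (by linarith [le_wSum hω x j, le_wSum hω y j]) (hK0 j)
    _ = (∑ j, K j) * (1 + wSum ω x + wSum ω y) := by rw [Finset.sum_mul]
    _ ≤ _ := mul_le_mul_of_nonneg_right (by linarith) (by linarith)

lemma exists_integrable_exp_wSum (hω : ∀ j, IsWeightFun (ω j)) :
    ∃ L, 0 < L ∧ ∀ lam, L ≤ lam → Integrable fun x => Real.exp (-(lam * wSum ω x)) := by
  choose L hL0 hL using fun j => (hω j).exists_integrable
  refine ⟨∑ j, L j + 1,
    by linarith [Finset.sum_nonneg fun j (_ : j ∈ Finset.univ) => (hL0 j).le],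
    fun lam hlam => ?_⟩
  have hle : ∀ j, L j ≤ lam := fun j => by
    linarith [Finset.single_le_sum (f := L) (fun i _ => (hL0 i).le) (Finset.mem_univ j)]
  have := Integrable.fintype_prod (𝕜 := ℝ) (fun j => hL j lam (hle j))
  refine this.congr (ae_of_all _ fun x => ?_)
  simp only [wSum, ← Real.exp_sum, Finset.mul_sum, Finset.sum_neg_distrib]

/-- Smooth functions all of whose partial derivatives are `O(e^{-λ Om})` for every `λ > 0`. -/
structure HasRapidDerivs (Om : (Fin N → ℝ) → ℝ) (h : (Fin N → ℝ) → ℂ) : Prop where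
  smooth : ContDiff ℝ (⊤ : ℕ∞) h
  decay : ∀ lam : ℝ, 0 < lam → ∀ α : Fin N → ℕ,
    ∃ C : ℝ, ∀ x, ‖pDpow α h x‖ ≤ C * Real.exp (-(lam * Om x))

/-- Measurable symbols that are `O(e^{-λ (Om x + Sig ξ)})` for every `λ > 0`. -/
structure IsRapidSymbol (Om Sig : (Fin N → ℝ) → ℝ) (F : (Fin N → ℝ) × (Fin N → ℝ) → ℂ) : Prop where
  measurable : Measurable F
  decay : ∀ lam : ℝ, 0 < lam →
    ∃ C : ℝ, ∀ x ξ, ‖F (x, ξ)‖ ≤ C * Real.exp (-(lam * (Om x + Sig ξ)))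

/-- The integrand `F(x,ξ) M_ξ T_x h(t)`. -/
def shiftTerm (F : (Fin N → ℝ) × (Fin N → ℝ) → ℂ) (h : (Fin N → ℝ) → ℂ) (t : Fin N → ℝ)
    (p : (Fin N → ℝ) × (Fin N → ℝ)) : ℂ := F p * Mod' p.2 (Tr p.1 h) t

/-- Superposition of time-frequency shifts of `h` against the symbol `F`. -/
def superpos (F : (Fin N → ℝ) × (Fin N → ℝ) → ℂ) (h : (Fin N → ℝ) → ℂ) (t : Fin N → ℝ) : ℂ :=
  ∫ p, shiftTerm F h t p

lemma supNorm_exp_mul_Dpow_lt_top_iff (Om : (Fin N → ℝ) → ℝ) (h : (Fin N → ℝ) → ℂ) (lam : ℝ)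
    (α : Fin N → ℕ) :
    supNorm (fun x => (Real.exp (lam * Om x) : ℂ) * Dpow α h x) < ⊤ ↔
      ∃ C : ℝ, ∀ x, ‖pDpow α h x‖ ≤ C * Real.exp (-(lam * Om x)) := by
  have hn : ∀ x, ‖(Real.exp (lam * Om x) : ℂ) * Dpow α h x‖ =
      Real.exp (lam * Om x) * ‖pDpow α h x‖ := by
    intro x
    rw [norm_mul, Complex.norm_real, Real.norm_of_nonneg (Real.exp_pos _).le, Dpow, norm_mul,
      norm_pow, norm_neg, Complex.norm_I, one_pow, one_mul]
  have hiff : ∀ (x : Fin N → ℝ) (C : ℝ), ‖pDpow α h x‖ ≤ C * Real.exp (-(lam * Om x)) ↔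
      ‖(Real.exp (lam * Om x) : ℂ) * Dpow α h x‖ ≤ C := by
    intro x C
    rw [hn, Real.exp_neg, ← div_eq_mul_inv, le_div_iff₀ (Real.exp_pos _), mul_comm]
  simp only [hiff, supNorm]
  constructor
  · intro hlt
    refine ⟨(⨆ x, (‖(Real.exp (lam * Om x) : ℂ) * Dpow α h x‖₊ : ℝ≥0∞)).toReal, fun x => ?_⟩
    have := ENNReal.toReal_mono hlt.ne
      (le_iSup (fun x => (‖(Real.exp (lam * Om x) : ℂ) * Dpow α h x‖₊ : ℝ≥0∞)) x)
    simpa using this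
  · rintro ⟨C, hC⟩
    refine lt_of_le_of_lt (iSup_le fun x => ?_) (ENNReal.ofReal_lt_top (r := C))
    rw [← enorm_eq_nnnorm, ← ofReal_norm]
    exact ENNReal.ofReal_le_ofReal (hC x)

lemma HasRapidDerivs.exists_norm_le {Om : (Fin N → ℝ) → ℝ} {h : (Fin N → ℝ) → ℂ}
    (hh : HasRapidDerivs Om h) {lam : ℝ} (hlam : 0 < lam) :
    ∃ C : ℝ, ∀ x, ‖h x‖ ≤ C * Real.exp (-(lam * Om x)) := by
  simpa only [pDpow_zero] using hh.decay lam hlam 0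

lemma HasRapidDerivs.pD {Om : (Fin N → ℝ) → ℝ} {h : (Fin N → ℝ) → ℂ}
    (hh : HasRapidDerivs Om h) (j : Fin N) : HasRapidDerivs Om (pD j h) where
  smooth := contDiff_pD hh.smooth j
  decay lam hlam α := by
    rw [pDpow_pD hh.smooth]
    exact hh.decay lam hlam _

lemma IsRapidSymbol.freq_mul (hω : ∀ j, IsWeightFun (ω j)) (hσ : ∀ j, IsWeightFun (σ j))
    {F : (Fin N → ℝ) × (Fin N → ℝ) → ℂ} (hF : IsRapidSymbol (wSum ω) (wSum σ) F) (j : Fin N) :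
    IsRapidSymbol (wSum ω) (wSum σ) (fun p => Complex.I * (p.2 j : ℂ) * F p) where
  measurable := by
    have := hF.measurable
    fun_prop
  decay lam hlam := by
    obtain ⟨c, b, hc, hb, hcb⟩ := (hσ j).exists_one_add_abs_le_exp
    obtain ⟨C, hC⟩ := hF.decay (lam + b) (by positivity)
    refine ⟨c * C, fun x ξ => ?_⟩
    have h1 : |ξ j| ≤ c * Real.exp (b * (wSum ω x + wSum σ ξ)) := by
      refine (by linarith : |ξ j| ≤ 1 + |ξ j|).trans ((hcb (ξ j)).trans ?_)
      gcongr
      linarith [le_wSum hσ ξ j, wSum_nonneg hω x]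
    calc ‖Complex.I * (ξ j : ℂ) * F (x, ξ)‖ = |ξ j| * ‖F (x, ξ)‖ := by simp
      _ ≤ (c * Real.exp (b * (wSum ω x + wSum σ ξ))) *
          (C * Real.exp (-((lam + b) * (wSum ω x + wSum σ ξ)))) :=
        mul_le_mul h1 (hC x ξ) (norm_nonneg _) (by positivity)
      _ = c * C * Real.exp (-(lam * (wSum ω x + wSum σ ξ))) := by
        rw [mul_mul_mul_comm, ← Real.exp_add]
        ring_nf

lemma norm_exp_I_mul_ofReal (r : ℝ) : ‖Complex.exp (Complex.I * (r : ℂ))‖ = 1 := by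
  rw [mul_comm, Complex.norm_exp_ofReal_mul_I]

lemma norm_shiftTerm (F : (Fin N → ℝ) × (Fin N → ℝ) → ℂ) (h : (Fin N → ℝ) → ℂ) (t : Fin N → ℝ)
    (p : (Fin N → ℝ) × (Fin N → ℝ)) : ‖shiftTerm F h t p‖ = ‖F p‖ * ‖h (t - p.1)‖ := by
  rw [shiftTerm, Mod', norm_mul, norm_mul, norm_exp_I_mul_ofReal, one_mul, Tr]

lemma exists_norm_shiftTerm_le (hω : ∀ j, IsWeightFun (ω j)) (hσ : ∀ j, IsWeightFun (σ j))
    {F : (Fin N → ℝ) × (Fin N → ℝ) → ℂ} (hF : IsRapidSymbol (wSum ω) (wSum σ) F)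
    {h : (Fin N → ℝ) → ℂ} (hh : HasRapidDerivs (wSum ω) h) {lam : ℝ} (hlam : 0 < lam) :
    ∃ C : ℝ, ∀ t p, ‖shiftTerm F h t p‖ ≤ C * Real.exp (-(lam * wSum ω t)) *
      (Real.exp (-(lam * wSum ω p.1)) * Real.exp (-(lam * wSum σ p.2))) := by
  obtain ⟨K, hK0, hK⟩ := exists_wSum_add_le hω
  obtain ⟨C₁, hC₁⟩ := hF.decay (lam * K + lam) (by positivity)
  obtain ⟨C₂, hC₂⟩ := hh.exists_norm_le (lam := lam * K) (by positivity)
  have hC₁_nonneg : 0 ≤ C₁ := nonneg_of_mul_nonneg_left ((norm_nonneg _).trans (hC₁ 0 0)) (Real.exp_pos _)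
  have hC₂_nonneg : 0 ≤ C₂ := nonneg_of_mul_nonneg_left ((norm_nonneg _).trans (hC₂ 0)) (Real.exp_pos _)
  refine ⟨C₁ * C₂ * Real.exp (lam * K), fun t p => ?_⟩
  obtain ⟨x, ξ⟩ := p
  have hsub := hK x (t - x)
  rw [add_sub_cancel] at hsub
  have hξ := mul_nonneg (mul_nonneg hlam.le hK0.le) (wSum_nonneg hσ ξ)
  have hsub' := mul_le_mul_of_nonneg_left hsub hlam.le
  rw [norm_shiftTerm]
  calc ‖F (x, ξ)‖ * ‖h (t - x)‖
      ≤ (C₁ * Real.exp (-((lam * K + lam) * (wSum ω x + wSum σ ξ)))) *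
        (C₂ * Real.exp (-(lam * K * wSum ω (t - x)))) :=
        mul_le_mul (hC₁ x ξ) (hC₂ _) (norm_nonneg _) (by positivity)
    _ = C₁ * C₂ * Real.exp (-((lam * K + lam) * (wSum ω x + wSum σ ξ)) +
          -(lam * K * wSum ω (t - x))) := by rw [Real.exp_add]; ring
    _ ≤ C₁ * C₂ * Real.exp (lam * K + -(lam * wSum ω t) +
          (-(lam * wSum ω x) + -(lam * wSum σ ξ))) := by
        refine mul_le_mul_of_nonneg_left (Real.exp_le_exp.2 ?_) (by positivity)
        linarith
    _ = _ := by
        simp only [Real.exp_add]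
        ring

lemma exists_integrable_exp_prod (hω : ∀ j, IsWeightFun (ω j)) (hσ : ∀ j, IsWeightFun (σ j)) :
    ∃ L, 0 < L ∧ ∀ lam, L ≤ lam → Integrable (fun t => Real.exp (-(lam * wSum ω t))) ∧
      Integrable (fun p : (Fin N → ℝ) × (Fin N → ℝ) =>
        Real.exp (-(lam * wSum ω p.1)) * Real.exp (-(lam * wSum σ p.2))) := by
  obtain ⟨L₁, hL₁, h₁⟩ := exists_integrable_exp_wSum hω
  obtain ⟨L₂, hL₂, h₂⟩ := exists_integrable_exp_wSum hσ
  refine ⟨L₁ + L₂, by positivity, fun lam hlam => ⟨h₁ lam (by linarith), ?_⟩⟩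
  exact (h₁ lam (by linarith)).mul_prod (h₂ lam (by linarith))

lemma continuous_dotR : Continuous fun p : (Fin N → ℝ) × (Fin N → ℝ) => dotR p.1 p.2 := by
  unfold dotR
  fun_prop

lemma measurable_shiftTerm {F : (Fin N → ℝ) × (Fin N → ℝ) → ℂ} (hF : Measurable F)
    {h : (Fin N → ℝ) → ℂ} (hh : Continuous h) :
    Measurable fun q : (Fin N → ℝ) × ((Fin N → ℝ) × (Fin N → ℝ)) => shiftTerm F h q.1 q.2 := by
  have h1 : Continuous fun q : (Fin N → ℝ) × ((Fin N → ℝ) × (Fin N → ℝ)) =>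
      Mod' q.2.2 (Tr q.2.1 h) q.1 := by
    have : Continuous fun q : (Fin N → ℝ) × ((Fin N → ℝ) × (Fin N → ℝ)) => dotR q.1 q.2.2 :=
      continuous_dotR.comp (by fun_prop : Continuous fun q : (Fin N → ℝ) ×
        ((Fin N → ℝ) × (Fin N → ℝ)) => (q.1, q.2.2))
    unfold Mod' Tr
    fun_prop
  exact (hF.comp measurable_snd).mul h1.measurable

lemma measurable_shiftTerm_right {F : (Fin N → ℝ) × (Fin N → ℝ) → ℂ} (hF : Measurable F)
    {h : (Fin N → ℝ) → ℂ} (hh : Continuous h) (t : Fin N → ℝ) : Measurable (shiftTerm F h t) :=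
  (measurable_shiftTerm hF hh).comp measurable_prodMk_left

lemma integrable_shiftTerm (hω : ∀ j, IsWeightFun (ω j)) (hσ : ∀ j, IsWeightFun (σ j))
    {F : (Fin N → ℝ) × (Fin N → ℝ) → ℂ} (hF : IsRapidSymbol (wSum ω) (wSum σ) F)
    {h : (Fin N → ℝ) → ℂ} (hh : HasRapidDerivs (wSum ω) h) (t : Fin N → ℝ) :
    Integrable (shiftTerm F h t) := by
  obtain ⟨L, hL, hint⟩ := exists_integrable_exp_prod hω hσ
  obtain ⟨C, hC⟩ := exists_norm_shiftTerm_le hω hσ hF hh hL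
  exact ((hint L le_rfl).2.const_mul _).mono'
    (measurable_shiftTerm_right hF.measurable hh.smooth.continuous t).aestronglyMeasurable
    (ae_of_all _ (hC t))

lemma integrable_shiftTerm_prod (hω : ∀ j, IsWeightFun (ω j)) (hσ : ∀ j, IsWeightFun (σ j))
    {F : (Fin N → ℝ) × (Fin N → ℝ) → ℂ} (hF : IsRapidSymbol (wSum ω) (wSum σ) F)
    {h : (Fin N → ℝ) → ℂ} (hh : HasRapidDerivs (wSum ω) h) :
    Integrable fun q : (Fin N → ℝ) × ((Fin N → ℝ) × (Fin N → ℝ)) => shiftTerm F h q.1 q.2 := by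
  obtain ⟨L, hL, hint⟩ := exists_integrable_exp_prod hω hσ
  obtain ⟨C, hC⟩ := exists_norm_shiftTerm_le hω hσ hF hh hL
  exact (((hint L le_rfl).1.const_mul C).mul_prod (hint L le_rfl).2).mono'
    (measurable_shiftTerm hF.measurable hh.smooth.continuous).aestronglyMeasurable
    (ae_of_all _ fun q => hC q.1 q.2)

lemma exists_norm_superpos_le (hω : ∀ j, IsWeightFun (ω j)) (hσ : ∀ j, IsWeightFun (σ j))
    {F : (Fin N → ℝ) × (Fin N → ℝ) → ℂ} (hF : IsRapidSymbol (wSum ω) (wSum σ) F)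
    {h : (Fin N → ℝ) → ℂ} (hh : HasRapidDerivs (wSum ω) h) {lam : ℝ} (hlam : 0 < lam) :
    ∃ C : ℝ, ∀ t, ‖superpos F h t‖ ≤ C * Real.exp (-(lam * wSum ω t)) := by
  obtain ⟨L, hL, hint⟩ := exists_integrable_exp_prod hω hσ
  obtain ⟨C, hC⟩ := exists_norm_shiftTerm_le hω hσ hF hh (add_pos hL hlam)
  have hC0 : 0 ≤ C := by
    refine nonneg_of_mul_nonneg_left (b := Real.exp (-((L + lam) * wSum ω 0)) *
      (Real.exp (-((L + lam) * wSum ω 0)) * Real.exp (-((L + lam) * wSum σ 0)))) ?_ (by positivity)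
    rw [← mul_assoc]
    exact (norm_nonneg _).trans (hC 0 (0, 0))
  refine ⟨C * ∫ p : (Fin N → ℝ) × (Fin N → ℝ),
    Real.exp (-((L + lam) * wSum ω p.1)) * Real.exp (-((L + lam) * wSum σ p.2)), fun t => ?_⟩
  have hI := (hint (L + lam) (by linarith)).2
  calc ‖superpos F h t‖ ≤ ∫ p : (Fin N → ℝ) × (Fin N → ℝ),
        C * Real.exp (-((L + lam) * wSum ω t)) *
          (Real.exp (-((L + lam) * wSum ω p.1)) * Real.exp (-((L + lam) * wSum σ p.2))) :=
        norm_integral_le_of_norm_le (hI.const_mul _) (ae_of_all _ (hC t))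
    _ = (C * ∫ p : (Fin N → ℝ) × (Fin N → ℝ), Real.exp (-((L + lam) * wSum ω p.1)) *
          Real.exp (-((L + lam) * wSum σ p.2))) * Real.exp (-((L + lam) * wSum ω t)) := by
        rw [integral_const_mul]; ring
    _ ≤ _ := by
        have := integral_nonneg (μ := volume) (f := fun p : (Fin N → ℝ) × (Fin N → ℝ) =>
          Real.exp (-((L + lam) * wSum ω p.1)) * Real.exp (-((L + lam) * wSum σ p.2)))
          fun p => by positivity
        gcongr
        · exact wSum_nonneg hω t
        · linarith

lemma hasFDerivAt_dotR_left (t ξ : Fin N → ℝ) :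
    HasFDerivAt (fun s => dotR s ξ)
      (∑ j, ξ j • ContinuousLinearMap.proj (R := ℝ) (φ := fun _ : Fin N => ℝ) j) t := by
  unfold dotR
  exact HasFDerivAt.fun_sum fun j _ => (hasFDerivAt_apply j t).mul_const (ξ j)

lemma differentiable_shiftTerm (F : (Fin N → ℝ) × (Fin N → ℝ) → ℂ) {h : (Fin N → ℝ) → ℂ}
    (hh : ContDiff ℝ (⊤ : ℕ∞) h) (p : (Fin N → ℝ) × (Fin N → ℝ)) :
    Differentiable ℝ fun t => shiftTerm F h t p := by
  intro t
  have h1 := (hh.differentiable (by simp)) (t - p.1)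
  have h2 : DifferentiableAt ℝ (fun s => dotR s p.2) t :=
    (hasFDerivAt_dotR_left t p.2).differentiableAt
  have h3 : DifferentiableAt ℝ (fun s => ((dotR s p.2 : ℝ) : ℂ)) t :=
    Complex.ofRealCLM.differentiableAt.comp t h2
  unfold shiftTerm Mod' Tr
  have h4 : DifferentiableAt ℝ (fun s => h (s - p.1)) t :=
    h1.comp t (differentiableAt_id.sub_const p.1)
  fun_prop

lemma pD_shiftTerm (F : (Fin N → ℝ) × (Fin N → ℝ) → ℂ) {h : (Fin N → ℝ) → ℂ}
    (hh : ContDiff ℝ (⊤ : ℕ∞) h) (p : (Fin N → ℝ) × (Fin N → ℝ)) (j : Fin N) (t : Fin N → ℝ) :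
    pD j (fun t => shiftTerm F h t p) t =
      shiftTerm (fun p => Complex.I * (p.2 j : ℂ) * F p) h t p + shiftTerm F (pD j h) t p := by
  have h1 := ((hh.differentiable (by simp)) (t - p.1)).hasFDerivAt.comp t
    ((hasFDerivAt_id t).sub_const p.1)
  have h2 := (((Complex.ofRealCLM.hasFDerivAt.comp t
    (hasFDerivAt_dotR_left t p.2)).const_mul Complex.I).cexp.mul h1).const_mul (F p)
  have h3 : HasFDerivAt (fun t => shiftTerm F h t p) _ t := h2
  rw [pD, h3.fderiv]
  simp [shiftTerm, Mod', Tr, pD, Pi.single_apply]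
  ring

lemma hasFDerivAt_superpos (hω : ∀ j, IsWeightFun (ω j)) (hσ : ∀ j, IsWeightFun (σ j))
    {F : (Fin N → ℝ) × (Fin N → ℝ) → ℂ} (hF : IsRapidSymbol (wSum ω) (wSum σ) F)
    {h : (Fin N → ℝ) → ℂ} (hh : HasRapidDerivs (wSum ω) h) (t : Fin N → ℝ) :
    Integrable (fun p => fderiv ℝ (fun s => shiftTerm F h s p) t) ∧
    HasFDerivAt (superpos F h) (∫ p, fderiv ℝ (fun s => shiftTerm F h s p) t) t := by
  obtain ⟨L, hL, hint⟩ := exists_integrable_exp_prod hω hσ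
  choose C₁ hC₁ using fun j => exists_norm_shiftTerm_le hω hσ (hF.freq_mul hω hσ j) hh hL
  choose C₂ hC₂ using fun j => exists_norm_shiftTerm_le hω hσ hF (hh.pD j) hL
  have hexp : ∀ s : Fin N → ℝ, Real.exp (-(L * wSum ω s)) ≤ 1 := fun s =>
    Real.exp_le_one_iff.2 (neg_nonpos.2 (mul_nonneg hL.le (wSum_nonneg hω s)))
  have hbound : ∀ (p : (Fin N → ℝ) × (Fin N → ℝ)) (s : Fin N → ℝ),
      ‖fderiv ℝ (fun s => shiftTerm F h s p) s‖ ≤ (∑ j, (|C₁ j| + |C₂ j|)) *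
        (Real.exp (-(L * wSum ω p.1)) * Real.exp (-(L * wSum σ p.2))) := by
    intro p s
    refine (norm_fderiv_le_sum_norm_pD _ _).trans ?_
    rw [Finset.sum_mul]
    refine Finset.sum_le_sum fun j _ => ?_
    rw [pD_shiftTerm F hh.smooth, add_mul]
    have hle : ∀ c : ℝ, c * Real.exp (-(L * wSum ω s)) ≤ |c| := fun c =>
      (mul_le_mul_of_nonneg_right (le_abs_self c) (Real.exp_pos _).le).trans
        (mul_le_of_le_one_right (abs_nonneg c) (hexp s))
    refine (norm_add_le _ _).trans (add_le_add ?_ ?_)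
    · exact (hC₁ j s p).trans (mul_le_mul_of_nonneg_right (hle _) (by positivity))
    · exact (hC₂ j s p).trans (mul_le_mul_of_nonneg_right (hle _) (by positivity))
  have hmeas : AEStronglyMeasurable (fun p => fderiv ℝ (fun s => shiftTerm F h s p) t) := by
    have : (fun p => fderiv ℝ (fun s => shiftTerm F h s p) t) = fun p => ∑ j,
        ContinuousLinearMap.smulRightL ℝ (Fin N → ℝ) ℂ
          (ContinuousLinearMap.proj (R := ℝ) (φ := fun _ : Fin N => ℝ) j)
          (shiftTerm (fun p => Complex.I * (p.2 j : ℂ) * F p) h t p + shiftTerm F (pD j h) t p) := by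
      ext1 p
      rw [fderiv_eq_sum_smulRight_pD]
      refine Finset.sum_congr rfl fun j _ => ?_
      rw [pD_shiftTerm F hh.smooth]
      rfl
    rw [this]
    refine Finset.aestronglyMeasurable_fun_sum _ fun j _ => ?_
    refine (ContinuousLinearMap.continuous _).comp_aestronglyMeasurable ?_
    exact ((measurable_shiftTerm_right (hF.freq_mul hω hσ j).measurable hh.smooth.continuous t).add
      (measurable_shiftTerm_right hF.measurable
        (hh.pD j).smooth.continuous t)).aestronglyMeasurable
  have hbint := (hint L le_rfl).2.const_mul (∑ j, (|C₁ j| + |C₂ j|))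
  refine ⟨hbint.mono' hmeas (ae_of_all _ fun p => hbound p t), ?_⟩
  exact hasFDerivAt_integral_of_dominated_of_fderiv_le (𝕜 := ℝ) (s := Set.univ)
    (F := fun s p => shiftTerm F h s p) univ_mem
    (Eventually.of_forall fun s => (measurable_shiftTerm_right hF.measurable
      hh.smooth.continuous s).aestronglyMeasurable)
    (integrable_shiftTerm hω hσ hF hh t) hmeas (ae_of_all _ fun p s _ => hbound p s) hbint
    (ae_of_all _ fun p s _ => (differentiable_shiftTerm F hh.smooth p s).hasFDerivAt)

lemma pD_superpos (hω : ∀ j, IsWeightFun (ω j)) (hσ : ∀ j, IsWeightFun (σ j))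
    {F : (Fin N → ℝ) × (Fin N → ℝ) → ℂ} (hF : IsRapidSymbol (wSum ω) (wSum σ) F)
    {h : (Fin N → ℝ) → ℂ} (hh : HasRapidDerivs (wSum ω) h) (j : Fin N) :
    pD j (superpos F h) =
      superpos (fun p => Complex.I * (p.2 j : ℂ) * F p) h + superpos F (pD j h) := by
  ext t
  obtain ⟨hi, hd⟩ := hasFDerivAt_superpos hω hσ hF hh t
  rw [pD, hd.fderiv, ContinuousLinearMap.integral_apply hi, Pi.add_apply, superpos, superpos,
    ← integral_add (integrable_shiftTerm hω hσ (hF.freq_mul hω hσ j) hh t)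
      (integrable_shiftTerm hω hσ hF (hh.pD j) t)]
  exact integral_congr_ae (ae_of_all _ fun p => pD_shiftTerm F hh.smooth p j t)

/-- Finite sums of superpositions of rapidly decaying functions against rapidly decaying symbols. -/
inductive IsSuperposSum (Om Sig : (Fin N → ℝ) → ℝ) : ((Fin N → ℝ) → ℂ) → Prop
  | superpos {F : (Fin N → ℝ) × (Fin N → ℝ) → ℂ} {h : (Fin N → ℝ) → ℂ}
      (hF : IsRapidSymbol Om Sig F) (hh : HasRapidDerivs Om h) : IsSuperposSum Om Sig (superpos F h)
  | add {f₁ f₂ : (Fin N → ℝ) → ℂ} (h₁ : IsSuperposSum Om Sig f₁) (h₂ : IsSuperposSum Om Sig f₂) :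
      IsSuperposSum Om Sig (f₁ + f₂)

lemma IsSuperposSum.differentiable (hω : ∀ j, IsWeightFun (ω j)) (hσ : ∀ j, IsWeightFun (σ j))
    {f : (Fin N → ℝ) → ℂ} (hf : IsSuperposSum (wSum ω) (wSum σ) f) : Differentiable ℝ f := by
  induction hf with
  | superpos hF hh => exact fun t => (hasFDerivAt_superpos hω hσ hF hh t).2.differentiableAt
  | add _ _ ih₁ ih₂ => exact ih₁.add ih₂

lemma IsSuperposSum.pD (hω : ∀ j, IsWeightFun (ω j)) (hσ : ∀ j, IsWeightFun (σ j))
    {f : (Fin N → ℝ) → ℂ} (hf : IsSuperposSum (wSum ω) (wSum σ) f) (j : Fin N) :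
    IsSuperposSum (wSum ω) (wSum σ) (pD j f) := by
  induction hf with
  | superpos hF hh =>
    rw [pD_superpos hω hσ hF hh]
    exact (IsSuperposSum.superpos (hF.freq_mul hω hσ j) hh).add (.superpos hF (hh.pD j))
  | @add f₁ f₂ h₁ h₂ ih₁ ih₂ =>
    have : _root_.pD j (f₁ + f₂) = _root_.pD j f₁ + _root_.pD j f₂ := by
      ext t
      simp only [_root_.pD, Pi.add_apply]
      rw [fderiv_add (h₁.differentiable hω hσ t) (h₂.differentiable hω hσ t)]
      rfl
    rw [this]
    exact ih₁.add ih₂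

lemma IsSuperposSum.exists_norm_le (hω : ∀ j, IsWeightFun (ω j)) (hσ : ∀ j, IsWeightFun (σ j))
    {f : (Fin N → ℝ) → ℂ} (hf : IsSuperposSum (wSum ω) (wSum σ) f) {lam : ℝ} (hlam : 0 < lam) :
    ∃ C : ℝ, ∀ t, ‖f t‖ ≤ C * Real.exp (-(lam * wSum ω t)) := by
  induction hf with
  | superpos hF hh => exact exists_norm_superpos_le hω hσ hF hh hlam
  | add _ _ ih₁ ih₂ =>
    obtain ⟨C₁, h₁⟩ := ih₁
    obtain ⟨C₂, h₂⟩ := ih₂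
    refine ⟨C₁ + C₂, fun t => (norm_add_le _ _).trans ?_⟩
    rw [add_mul]
    exact add_le_add (h₁ t) (h₂ t)

lemma hasRapidDerivs_superpos (hω : ∀ j, IsWeightFun (ω j)) (hσ : ∀ j, IsWeightFun (σ j))
    {F : (Fin N → ℝ) × (Fin N → ℝ) → ℂ} (hF : IsRapidSymbol (wSum ω) (wSum σ) F)
    {h : (Fin N → ℝ) → ℂ} (hh : HasRapidDerivs (wSum ω) h) :
    HasRapidDerivs (wSum ω) (superpos F h) where
  smooth := contDiff_of_stable (P := IsSuperposSum (wSum ω) (wSum σ))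
    (fun _ hf j => hf.pD hω hσ j) (fun _ hf => hf.differentiable hω hσ) (.superpos hF hh)
  decay _ hlam α := (pDpow_mem_of_stable (P := IsSuperposSum (wSum ω) (wSum σ))
    (fun _ hf j => hf.pD hω hσ j) α (.superpos hF hh)).exists_norm_le hω hσ hlam

lemma HasRapidDerivs.integrable (hω : ∀ j, IsWeightFun (ω j)) {h : (Fin N → ℝ) → ℂ}
    (hh : HasRapidDerivs (wSum ω) h) : Integrable h := by
  obtain ⟨L, hL, hint⟩ := exists_integrable_exp_wSum hω
  obtain ⟨C, hC⟩ := hh.exists_norm_le hL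
  exact ((hint L le_rfl).const_mul C).mono' hh.smooth.continuous.aestronglyMeasurable
    (ae_of_all _ hC)

lemma dotR_add_left (x y ξ : Fin N → ℝ) : dotR (x + y) ξ = dotR x ξ + dotR y ξ := by
  simp [dotR, add_mul, Finset.sum_add_distrib]

lemma dotR_sub_right (x ξ η : Fin N → ℝ) : dotR x (ξ - η) = dotR x ξ - dotR x η := by
  simp [dotR, mul_sub, Finset.sum_sub_distrib]

lemma dotR_neg_left (x ξ : Fin N → ℝ) : dotR (-x) ξ = -dotR x ξ := by
  simp [dotR]

lemma dotR_comm (x ξ : Fin N → ℝ) : dotR x ξ = dotR ξ x := by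
  simp [dotR, mul_comm]

/-- The symbol representing the Fourier transform of a superposition as a superposition. -/
def dualSymbol (F : (Fin N → ℝ) × (Fin N → ℝ) → ℂ) (q : (Fin N → ℝ) × (Fin N → ℝ)) : ℂ :=
  Complex.exp (Complex.I * (-dotR q.2 q.1 : ℝ)) * F (-q.2, q.1)

lemma IsRapidSymbol.dualSymbol (hω : ∀ j, IsWeightFun (ω j))
    {F : (Fin N → ℝ) × (Fin N → ℝ) → ℂ} (hF : IsRapidSymbol (wSum ω) (wSum σ) F) :
    IsRapidSymbol (wSum σ) (wSum ω) (dualSymbol F) where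
  measurable := by
    have h1 : Measurable fun q : (Fin N → ℝ) × (Fin N → ℝ) => F (-q.2, q.1) :=
      hF.measurable.comp (by fun_prop)
    have h2 : Measurable fun q : (Fin N → ℝ) × (Fin N → ℝ) => dotR q.2 q.1 :=
      (continuous_dotR.comp continuous_swap).measurable
    exact (Complex.measurable_exp.comp ((Complex.measurable_ofReal.comp h2.neg).const_mul _)).mul h1
  decay lam hlam := by
    obtain ⟨C, hC⟩ := hF.decay lam hlam
    refine ⟨C, fun y z => ?_⟩
    rw [_root_.dualSymbol, norm_mul, norm_exp_I_mul_ofReal, one_mul, add_comm, ← wSum_neg hω z]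
    exact hC (-z) y

lemma integral_fourier_shiftTerm (F : (Fin N → ℝ) × (Fin N → ℝ) → ℂ) (h : (Fin N → ℝ) → ℂ)
    (η : Fin N → ℝ) (p : (Fin N → ℝ) × (Fin N → ℝ)) :
    ∫ t, Complex.exp (-(Complex.I * (dotR t η : ℂ))) * shiftTerm F h t p =
      shiftTerm (dualSymbol F) (FT h) η (p.2, -p.1) := by
  rw [← integral_add_right_eq_self _ p.1]
  simp only [shiftTerm, Mod', Tr, dualSymbol, FT]
  rw [← integral_const_mul, ← integral_const_mul]
  refine integral_congr_ae (ae_of_all _ fun s => ?_)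
  simp only [add_sub_cancel_right, neg_neg, Prod.mk.eta, dotR_add_left, dotR_sub_right,
    dotR_neg_left, dotR_comm η (-p.1)]
  have h2 : ∀ a b u v : ℂ, Complex.exp a * (u * (Complex.exp b * v)) =
      Complex.exp (a + b) * (u * v) := fun a b u v => by rw [Complex.exp_add]; ring
  have h3 : ∀ a b c u v : ℂ, Complex.exp a * u * (Complex.exp b * (Complex.exp c * v)) =
      Complex.exp (a + b + c) * (u * v) := fun a b c u v => by
    rw [Complex.exp_add, Complex.exp_add]; ring
  rw [h2, h3]
  congr 2
  push_cast
  ring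

lemma FT_superpos (hω : ∀ j, IsWeightFun (ω j)) (hσ : ∀ j, IsWeightFun (σ j))
    {F : (Fin N → ℝ) × (Fin N → ℝ) → ℂ} (hF : IsRapidSymbol (wSum ω) (wSum σ) F)
    {h : (Fin N → ℝ) → ℂ} (hh : HasRapidDerivs (wSum ω) h) :
    FT (superpos F h) = superpos (dualSymbol F) (FT h) := by
  ext η
  have hint : Integrable (Function.uncurry fun (t : Fin N → ℝ)
      (p : (Fin N → ℝ) × (Fin N → ℝ)) =>
        Complex.exp (-(Complex.I * (dotR t η : ℂ))) * shiftTerm F h t p)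
      (volume.prod volume) := by
    have hc : Continuous fun q : (Fin N → ℝ) × ((Fin N → ℝ) × (Fin N → ℝ)) => dotR q.1 η :=
      continuous_dotR.comp (by fun_prop : Continuous fun q : (Fin N → ℝ) ×
        ((Fin N → ℝ) × (Fin N → ℝ)) => (q.1, η))
    refine (integrable_shiftTerm_prod hω hσ hF hh).bdd_mul (c := 1)
      (Continuous.aestronglyMeasurable (by fun_prop)) (ae_of_all _ fun q => ?_)
    rw [← mul_neg, ← Complex.ofReal_neg, norm_exp_I_mul_ofReal]
  have hmp : MeasurePreserving (fun p : (Fin N → ℝ) × (Fin N → ℝ) => (p.2, -p.1)) :=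
    ((MeasurePreserving.id volume).prod (Measure.measurePreserving_neg volume)).comp
      Measure.measurePreserving_swap
  let e : (Fin N → ℝ) × (Fin N → ℝ) ≃ᵐ (Fin N → ℝ) × (Fin N → ℝ) :=
    MeasurableEquiv.prodComm.trans ((MeasurableEquiv.refl _).prodCongr (MeasurableEquiv.neg _))
  calc FT (superpos F h) η
      = ∫ t, ∫ p, Complex.exp (-(Complex.I * (dotR t η : ℂ))) * shiftTerm F h t p :=
        integral_congr_ae (ae_of_all _ fun t => (integral_const_mul _ _).symm)
    _ = ∫ p, ∫ t, Complex.exp (-(Complex.I * (dotR t η : ℂ))) * shiftTerm F h t p :=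
        integral_integral_swap hint
    _ = ∫ p : (Fin N → ℝ) × (Fin N → ℝ), shiftTerm (dualSymbol F) (FT h) η (p.2, -p.1) :=
        integral_congr_ae (ae_of_all _ (integral_fourier_shiftTerm F h η))
    _ = superpos (dualSymbol F) (FT h) η :=
        MeasurePreserving.integral_comp hmp e.measurableEmbedding _

end

/-- Superposition of time-frequency shifts against a rapidly decaying symbol
produces an element of `S_Ω^Σ` (Proposition 2.8 of the paper). -/
theorem statement_3 (N : ℕ) (ω σ : Fin N → ℝ → ℝ)
    (hω : ∀ j, IsWeightFun (ω j)) (hσ : ∀ j, IsWeightFun (σ j))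
    (g : (Fin N → ℝ) → ℂ) (hg : MemS (wSum ω) (wSum σ) g)
    (F : (Fin N → ℝ) → (Fin N → ℝ) → ℂ)
    (hFmeas : Measurable (fun p : (Fin N → ℝ) × (Fin N → ℝ) => F p.1 p.2))
    (hFdec : ∀ lam : ℝ, 0 < lam → ∃ C : ℝ, 0 < C ∧ ∀ x ξ : Fin N → ℝ,
      ‖F x ξ‖ ≤ C * Real.exp (-(lam * (wSum ω x + wSum σ ξ)))) :
    (∀ t : Fin N → ℝ,
      Integrable (fun p : (Fin N → ℝ) × (Fin N → ℝ) => F p.1 p.2 * Mod' p.2 (Tr p.1 g) t)) ∧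
    MemS (wSum ω) (wSum σ)
      (fun t => ∫ p : (Fin N → ℝ) × (Fin N → ℝ), F p.1 p.2 * Mod' p.2 (Tr p.1 g) t) := by
  have hF : IsRapidSymbol (wSum ω) (wSum σ) fun p => F p.1 p.2 :=
    ⟨hFmeas, fun lam hlam => (hFdec lam hlam).imp fun C hC => hC.2⟩
  have hg₁ : HasRapidDerivs (wSum ω) g :=
    ⟨hg.smooth, fun lam hlam α =>
      (supNorm_exp_mul_Dpow_lt_top_iff _ _ _ _).1 (hg.decay lam hlam α)⟩
  have hg₂ : HasRapidDerivs (wSum σ) (FT g) :=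
    ⟨hg.smooth_ft, fun lam hlam α =>
      (supNorm_exp_mul_Dpow_lt_top_iff _ _ _ _).1 (hg.decay_ft lam hlam α)⟩
  have hf := hasRapidDerivs_superpos hω hσ hF hg₁
  have hft : HasRapidDerivs (wSum σ) (FT (superpos (fun p => F p.1 p.2) g)) := by
    rw [FT_superpos hω hσ hF hg₁]
    exact hasRapidDerivs_superpos hσ hω (hF.dualSymbol hω) hg₂
  exact ⟨integrable_shiftTerm hω hσ hF hg₁, hf.integrable hω, hf.smooth, hft.smooth,
    fun lam hlam α => (supNorm_exp_mul_Dpow_lt_top_iff _ _ _ _).2 (hf.decay lam hlam α),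
    fun lam hlam α => (supNorm_exp_mul_Dpow_lt_top_iff _ _ _ _).2 (hft.decay lam hlam α)⟩

end
end

section
/- Let Ω, Σ be non-isotropic weights on ℝ^N built from weight functions ω_1,…,ω_N, σ_1,…,σ_N, with associated conjugate weights Ω*, Σ*. Let f be a Schwartz function on ℝ^N satisfying: (a) for each λ > 0 and β ∈ ℕ_0^N there exists C_{β,λ} > 0 such that for every α ∈ ℕ_0^N, ‖x^β D^α f‖_∞ ≤ C_{β,λ} · exp(λΣ*(α/λ)); and (b) for each μ > 0 and α ∈ ℕ_0^N there exists C_{α,μ} > 0 such that for every β ∈ ℕ_0^N, ‖x^β D^α f‖_∞ ≤ C_{α,μ} · exp(μΩ*(β/μ)). Then f ∈ S_Ω^Σ(ℝ^N). -/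
open MeasureTheory Filter
open scoped ENNReal NNReal

noncomputable section

/-- Young conjugate `φ*_ω(s) = sup_{t ≥ 0} (ts - ω(e^t))`. -/
def youngStar (ω : ℝ → ℝ) (s : ℝ) : ℝ := sSup ((fun t => t * s - ω (Real.exp t)) '' Set.Ici 0)

/-- For `y ∈ [0,∞)^M`, `Ω*(y) = φ*_{ω_1}(y_1) + ⋯ + φ*_{ω_M}(y_M)`. -/
def starSum {M : ℕ} (ω : Fin M → ℝ → ℝ) (y : Fin M → ℝ) : ℝ := ∑ j, youngStar (ω j) (y j)

lemma IsWeightFun.exists_subgradient {ω : ℝ → ℝ} (hω : IsWeightFun ω) {t : ℝ} (ht : 0 ≤ t) :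
    ∃ s, 0 ≤ s ∧ ∀ u, 0 ≤ u → ω (Real.exp t) + s * (u - t) ≤ ω (Real.exp u) := by
  have hmono : ∀ u v : ℝ, u ≤ v → ω (Real.exp u) ≤ ω (Real.exp v) := fun u v huv =>
    hω.mono (Real.exp_pos u).le (Real.exp_pos v).le (Real.exp_le_exp.2 huv)
  rcases ht.eq_or_lt with rfl | ht'
  · exact ⟨0, le_rfl, fun u hu => by simpa using hmono 0 u hu⟩
  have hint : t ∈ interior (Set.Ici (0 : ℝ)) := by simpa using ht'
  have hc := hω.deltaCond
  set φ := fun t => ω (Real.exp t) with hφ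
  have key : ∀ u, 0 ≤ u → φ t + derivWithin φ (Set.Ioi t) t * (u - t) ≤ φ u := by
    intro u hu
    rcases lt_trichotomy u t with h | rfl | h
    · have h1 := (hc.slope_le_leftDeriv_of_mem_interior hu hint h).trans
        (hc.leftDeriv_le_rightDeriv_of_mem_interior hint)
      rw [slope_def_field, div_le_iff₀ (by linarith)] at h1
      linarith
    · simp
    · have h1 := hc.rightDeriv_le_slope_of_mem_interior hint hu h
      rw [slope_def_field, le_div_iff₀ (by linarith)] at h1
      linarith
  refine ⟨_, ?_, key⟩
  have h0 := key 0 le_rfl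
  have h1 : φ 0 ≤ φ t := hmono 0 t ht
  by_contra! hneg
  nlinarith

/-- For large `μ`, suitable integer powers of `|x|` dominate `e^{λω}` with a loss governed by the
Young conjugate of `ω`. -/
lemma IsWeightFun.exists_pow_ge {ω : ℝ → ℝ} (hω : IsWeightFun ω) {lam : ℝ} (hlam : 0 < lam) :
    ∃ m : ℝ, ∀ mu : ℝ, m ≤ mu → 0 < mu → ∃ K : ℝ, 0 < K ∧ ∀ x : ℝ, ∃ β : ℕ,
      Real.exp (lam * ω x) * Real.exp (mu * youngStar ω ((β : ℝ) / mu)) ≤ K * |x| ^ β := by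
  obtain ⟨a, b, hb, hab⟩ := hω.gammaCond
  refine ⟨lam + 1 / b, fun mu hmu hmu0 =>
    ⟨Real.exp (lam * ω 1) + Real.exp (-(a / b)), by positivity, fun x => ?_⟩⟩
  rcases le_or_gt |x| 1 with hx | hx
  · refine ⟨0, ?_⟩
    have h1 : youngStar ω (((0 : ℕ) : ℝ) / mu) ≤ 0 := by
      refine Real.sSup_nonpos ?_
      rintro _ ⟨t, -, rfl⟩
      have := hω.nonneg (Real.exp t)
      simpa using this
    have h2 : ω x ≤ ω 1 := by
      rw [hω.eq_abs x]
      exact hω.mono (abs_nonneg x) (Set.mem_Ici.2 zero_le_one) hx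
    have h3 : Real.exp (mu * youngStar ω (((0 : ℕ) : ℝ) / mu)) ≤ 1 :=
      Real.exp_le_one_iff.2 (mul_nonpos_of_nonneg_of_nonpos hmu0.le h1)
    have h4 : Real.exp (lam * ω x) ≤ Real.exp (lam * ω 1) := by gcongr
    calc _ ≤ Real.exp (lam * ω 1) * 1 := by gcongr
      _ ≤ _ := by
        have := Real.exp_pos (-(a / b))
        simp only [pow_zero, mul_one]
        linarith
  · have hx0 : 0 < |x| := by linarith
    have ht : 0 < Real.log |x| := Real.log_pos hx
    set t := Real.log |x| with htdef
    have het : Real.exp t = |x| := Real.exp_log hx0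
    obtain ⟨s, hs, hsub⟩ := hω.exists_subgradient ht.le
    rw [het, ← hω.eq_abs x] at hsub
    refine ⟨⌊s * mu⌋₊, ?_⟩
    set β := ⌊s * mu⌋₊
    have hβ1 : (β : ℝ) ≤ s * mu := Nat.floor_le (by positivity)
    have hβ2 : s * mu < β + 1 := Nat.lt_floor_add_one _
    have hy : youngStar ω ((β : ℝ) / mu) ≤ t * s - ω x := by
      refine csSup_le (Set.Nonempty.image _ ⟨0, Set.self_mem_Ici⟩) ?_
      rintro _ ⟨u, hu, rfl⟩
      have h1 := hsub u hu
      have h2 : u * ((β : ℝ) / mu) ≤ u * s :=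
        mul_le_mul_of_nonneg_left ((div_le_iff₀ hmu0).2 hβ1) hu
      dsimp only
      linarith
    have hω1 : a / b + t ≤ 1 / b * ω x := by
      have h1 := hab |x| (abs_nonneg x)
      rw [← hω.eq_abs x] at h1
      have h2 : t ≤ Real.log (1 + |x|) := Real.log_le_log hx0 (by linarith)
      have h3 : a + b * t ≤ ω x := by nlinarith
      calc a / b + t = 1 / b * (a + b * t) := by field_simp
        _ ≤ _ := by gcongr
    have hω2 : 1 / b * ω x ≤ (mu - lam) * ω x :=
      mul_le_mul_of_nonneg_right (by linarith) (hω.nonneg x)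
    have hmain : lam * ω x + mu * youngStar ω ((β : ℝ) / mu) ≤ -(a / b) + β * t := by
      nlinarith [mul_le_mul_of_nonneg_left hy hmu0.le, mul_le_mul_of_nonneg_right hβ2.le ht.le]
    calc _ = Real.exp (lam * ω x + mu * youngStar ω ((β : ℝ) / mu)) := (Real.exp_add _ _).symm
      _ ≤ Real.exp (-(a / b) + β * t) := Real.exp_le_exp.2 hmain
      _ = Real.exp (-(a / b)) * |x| ^ β := by
        rw [Real.exp_add, Real.exp_nat_mul, het]
      _ ≤ _ := by
        gcongr
        have := Real.exp_pos (lam * ω 1)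
        linarith

lemma exists_exp_wSum_mul_norm_le {N : ℕ} {ω : Fin N → ℝ → ℝ} (hω : ∀ j, IsWeightFun (ω j))
    {g : (Fin N → ℝ) → ℂ}
    (hg : ∀ mu : ℝ, 0 < mu → ∃ C : ℝ, ∀ (β : Fin N → ℕ) (x : Fin N → ℝ),
      (∏ j, |x j| ^ β j) * ‖g x‖ ≤ C * Real.exp (mu * starSum ω (fun j => (β j : ℝ) / mu)))
    {lam : ℝ} (hlam : 0 < lam) :
    ∃ C : ℝ, ∀ x, Real.exp (lam * wSum ω x) * ‖g x‖ ≤ C := by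
  choose m hm using fun j => (hω j).exists_pow_ge hlam
  have hmu0 : 0 < 1 + ∑ j, |m j| := by positivity
  set mu := 1 + ∑ j, |m j| with hmu
  have hle : ∀ j, m j ≤ mu := fun j => by
    have : |m j| ≤ ∑ j, |m j| := Finset.single_le_sum (f := fun j => |m j|)
      (fun i _ => abs_nonneg _) (Finset.mem_univ j)
    have := le_abs_self (m j)
    linarith
  choose K hK hβ using fun j => hm j mu (hle j) hmu0
  obtain ⟨C, hC⟩ := hg mu hmu0
  refine ⟨(∏ j, K j) * C, fun x => ?_⟩
  choose β hβx using fun j => hβ j (x j)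
  have hprod := Finset.prod_le_prod (s := Finset.univ) (fun j _ => by positivity)
    (fun j _ => hβx j)
  rw [Finset.prod_mul_distrib, Finset.prod_mul_distrib, ← Real.exp_sum, ← Real.exp_sum,
    ← Finset.mul_sum, ← Finset.mul_sum] at hprod
  have hKpos : 0 ≤ ∏ j, K j := Finset.prod_nonneg fun j _ => (hK j).le
  refine le_of_mul_le_mul_right ?_ (Real.exp_pos (mu * starSum ω (fun j => (β j : ℝ) / mu)))
  calc _ = (Real.exp (lam * wSum ω x) * Real.exp (mu * starSum ω (fun j => (β j : ℝ) / mu)))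
        * ‖g x‖ := by ring
    _ ≤ ((∏ j, K j) * ∏ j, |x j| ^ β j) * ‖g x‖ :=
      mul_le_mul_of_nonneg_right hprod (norm_nonneg _)
    _ = (∏ j, K j) * ((∏ j, |x j| ^ β j) * ‖g x‖) := by ring
    _ ≤ (∏ j, K j) * (C * Real.exp (mu * starSum ω (fun j => (β j : ℝ) / mu))) := by
      exact mul_le_mul_of_nonneg_left (hC β x) hKpos
    _ = _ := by ring

lemma pDpow_induction {N : ℕ} {P : ((Fin N → ℝ) → ℂ) → Prop}
    (hP : ∀ j g, P g → P (pD j g)) (α : Fin N → ℕ) {g : (Fin N → ℝ) → ℂ} (hg : P g) :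
    P (pDpow α g) := by
  have hit : ∀ j n g, P g → P ((pD j)^[n] g) := by
    intro j n
    induction n with
    | zero => exact fun g hg => hg
    | succ n ih => exact fun g hg => ih _ (hP j g hg)
  unfold pDpow
  rw [List.ofFn_eq_map]
  induction List.finRange N with
  | nil => exact hg
  | cons j l ih => exact hit j _ _ ih

lemma FT_eq_fourierIntegral {N : ℕ} : ∃ L : (Fin N → ℝ) →L[ℝ] (Fin N → ℝ) →L[ℝ] ℝ,
    (∀ x ξ, L x ξ = (2 * Real.pi)⁻¹ * dotR x ξ) ∧
    ∀ f : (Fin N → ℝ) → ℂ,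
      FT f = VectorFourier.fourierIntegral Real.fourierChar volume L.toLinearMap₁₂ f := by
  refine ⟨∑ j, (2 * Real.pi)⁻¹ • (ContinuousLinearMap.proj (R := ℝ) (φ := fun _ : Fin N => ℝ)
    j).smulRight (ContinuousLinearMap.proj (R := ℝ) (φ := fun _ : Fin N => ℝ) j), ?_, ?_⟩
  · intro x ξ
    simp [dotR, Finset.mul_sum]
  · intro f
    ext ξ
    simp only [FT, VectorFourier.fourierIntegral]
    refine integral_congr_ae (Eventually.of_forall fun x => ?_)
    simp only [Circle.smul_def, Real.fourierChar_apply, smul_eq_mul]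
    congr 2
    simp [dotR, ← Finset.mul_sum]
    field_simp

lemma dotR_single_right {N : ℕ} (x : Fin N → ℝ) (j : Fin N) : dotR x (Pi.single j 1) = x j := by
  simp [dotR, Pi.single_apply]

lemma dotR_single_left {N : ℕ} (x : Fin N → ℝ) (j : Fin N) : dotR (Pi.single j 1) x = x j := by
  simp [dotR, Pi.single_apply]

lemma contDiff_FT {N : ℕ} (h : SchwartzMap (Fin N → ℝ) ℂ) : ContDiff ℝ (⊤ : ℕ∞) (FT h) := by
  obtain ⟨L, -, hL⟩ := FT_eq_fourierIntegral (N := N)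
  rw [hL]
  exact VectorFourier.contDiff_fourierIntegral L fun n _ => h.integrable_pow_mul volume n

lemma norm_FT_le {N : ℕ} (h : (Fin N → ℝ) → ℂ) (ξ : Fin N → ℝ) : ‖FT h ξ‖ ≤ ∫ x, ‖h x‖ := by
  obtain ⟨L, -, hL⟩ := FT_eq_fourierIntegral (N := N)
  rw [hL]
  exact VectorFourier.norm_fourierIntegral_le_integral_norm ..

lemma exists_pD_eq {N : ℕ} (h : SchwartzMap (Fin N → ℝ) ℂ) (j : Fin N) :
    ∃ g : SchwartzMap (Fin N → ℝ) ℂ, ⇑g = pD j h :=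
  ⟨LineDeriv.lineDerivOp (Pi.single j 1) h, funext fun x =>
    SchwartzMap.lineDerivOp_apply_eq_fderiv (Pi.single j 1) h x⟩

lemma exists_FT_eq_pD_FT {N : ℕ} (h : SchwartzMap (Fin N → ℝ) ℂ) (j : Fin N) :
    ∃ g : SchwartzMap (Fin N → ℝ) ℂ, FT g = pD j (FT h) := by
  obtain ⟨L, hL1, hL⟩ := FT_eq_fourierIntegral (N := N)
  have hgrowth : (fun x : Fin N → ℝ => x j).HasTemperateGrowth :=
    (ContinuousLinearMap.proj (R := ℝ) (φ := fun _ : Fin N => ℝ) j).hasTemperateGrowth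
  refine ⟨(-Complex.I) • SchwartzMap.smulLeftCLM ℂ (fun x : Fin N → ℝ => x j) h, ?_⟩
  ext ξ
  have hint : Integrable (VectorFourier.fourierSMulRight L h) := by
    refine Integrable.mono' ((h.integrable_pow_mul volume 1).const_mul (2 * Real.pi * ‖L‖))
      h.continuous.aestronglyMeasurable.fourierSMulRight (Eventually.of_forall fun v => ?_)
    simpa [mul_assoc] using VectorFourier.norm_fourierSMulRight_le L h v
  unfold pD
  rw [hL h, (VectorFourier.hasFDerivAt_fourierIntegral L h.integrable
    (by simpa using h.integrable_pow_mul volume 1) ξ).fderiv,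
    Real.fourierIntegral_continuousLinearMap_apply' hint, hL]
  congr 1
  ext v
  simp [hL1, dotR_single_right, SchwartzMap.smulLeftCLM_apply_apply hgrowth]
  field_simp

lemma FT_pD {N : ℕ} (h : SchwartzMap (Fin N → ℝ) ℂ) (j : Fin N) (ξ : Fin N → ℝ) :
    FT (pD j h) ξ = Complex.I * ξ j * FT h ξ := by
  obtain ⟨L, hL1, hL⟩ := FT_eq_fourierIntegral (N := N)
  have hint : Integrable (fderiv ℝ h) := (SchwartzMap.fderivCLM ℝ _ _ h).integrable
  have key := congrArg (fun T => T ξ (Pi.single j 1))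
    (VectorFourier.fourierIntegral_fderiv L h.integrable h.differentiable hint)
  rw [Real.fourierIntegral_continuousLinearMap_apply' hint] at key
  rw [hL, hL]
  refine key.trans ?_
  simp [hL1, dotR_single_left]
  field_simp

lemma norm_FT_pDpow {N : ℕ} (h : SchwartzMap (Fin N → ℝ) ℂ) (β : Fin N → ℕ) (ξ : Fin N → ℝ) :
    (∏ j, |ξ j| ^ β j) * ‖FT h ξ‖ = ‖FT (pDpow β h) ξ‖ := by
  have hit : ∀ (j : Fin N) (n : ℕ) (g : SchwartzMap (Fin N → ℝ) ℂ),
      ∃ g' : SchwartzMap (Fin N → ℝ) ℂ, ⇑g' = (pD j)^[n] g ∧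
        ‖FT g' ξ‖ = |ξ j| ^ n * ‖FT g ξ‖ := by
    intro j n
    induction n with
    | zero => exact fun g => ⟨g, rfl, by simp⟩
    | succ n ih =>
      intro g
      obtain ⟨g₁, hg₁⟩ := exists_pD_eq g j
      obtain ⟨g₂, hg₂, hn⟩ := ih g₁
      refine ⟨g₂, by rw [hg₂, hg₁]; rfl, ?_⟩
      rw [hn, hg₁, FT_pD]
      simp [pow_succ, mul_assoc]
  unfold pDpow
  rw [List.ofFn_eq_map, Fin.prod_univ_def]
  suffices H : ∀ l : List (Fin N), ∃ g : SchwartzMap (Fin N → ℝ) ℂ,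
      ⇑g = ((l.map fun j => (pD j)^[β j]).foldr (· ∘ ·) id) h ∧
        ‖FT g ξ‖ = (l.map fun j => |ξ j| ^ β j).prod * ‖FT h ξ‖ by
    obtain ⟨g, hg, hn⟩ := H (List.finRange N)
    rw [← hg, hn]
  intro l
  induction l with
  | nil => exact ⟨h, rfl, by simp⟩
  | cons j l ih =>
    obtain ⟨g, hg, hn⟩ := ih
    obtain ⟨g', hg', hn'⟩ := hit j (β j) g
    refine ⟨g', by rw [hg', hg]; rfl, ?_⟩
    rw [hn', hn, List.map_cons, List.prod_cons, mul_assoc]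

lemma integral_norm_le_of_prod_one_add_sq_mul_le {N : ℕ} {g : (Fin N → ℝ) → ℂ} {M : ℝ}
    (hg : ∀ x, (∏ j, (1 + x j ^ 2)) * ‖g x‖ ≤ M) :
    ∫ x, ‖g x‖ ≤ (∫ x : Fin N → ℝ, ∏ j, (1 + x j ^ 2)⁻¹) * M := by
  rw [← integral_mul_const]
  refine integral_mono_of_nonneg (Eventually.of_forall fun x => norm_nonneg _)
    ((Integrable.fintype_prod (f := fun _ : Fin N => fun y : ℝ => (1 + y ^ 2)⁻¹)
      fun _ => integrable_inv_one_add_sq).mul_const M) (Eventually.of_forall fun x => ?_)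
  have hpos : 0 < ∏ j, (1 + x j ^ 2) := Finset.prod_pos fun j _ => by positivity
  simp only [Finset.prod_inv_distrib]
  rw [inv_mul_eq_div, le_div_iff₀ hpos, mul_comm]
  exact hg x

lemma hasDerivAt_FT_line {N : ℕ} (h : SchwartzMap (Fin N → ℝ) ℂ) (j : Fin N) (ξ : Fin N → ℝ)
    (s : ℝ) : HasDerivAt (fun s : ℝ => FT h (ξ + s • Pi.single j 1))
      (pD j (FT h) (ξ + s • Pi.single j 1)) s := by
  have h1 : HasDerivAt (fun s : ℝ => ξ + s • (Pi.single j 1 : Fin N → ℝ)) (Pi.single j 1) s := by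
    simpa using ((hasDerivAt_id s).smul_const (Pi.single j 1 : Fin N → ℝ)).const_add ξ
  exact (((contDiff_FT h).differentiable (by simp)) _).hasFDerivAt.comp_hasDerivAt s h1

/-- A quantitative first-order Taylor bound for the Fourier transform of a Schwartz function. -/
lemma exists_norm_FT_taylor_le {N : ℕ} (h : SchwartzMap (Fin N → ℝ) ℂ) (j : Fin N) :
    ∃ M : ℝ, ∀ (ξ : Fin N → ℝ) (s : ℝ),
      ‖FT h (ξ + s • Pi.single j 1) - FT h ξ - s • pD j (FT h) ξ‖ ≤ M * |s| * |s| := by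
  obtain ⟨g₁, hg₁⟩ := exists_FT_eq_pD_FT h j
  obtain ⟨g₂, hg₂⟩ := exists_FT_eq_pD_FT g₁ j
  refine ⟨∫ x, ‖g₂ x‖, fun ξ s => ?_⟩
  set M := ∫ x, ‖g₂ x‖
  have hM : 0 ≤ M := integral_nonneg fun x => norm_nonneg _
  have hlip : ∀ r : ℝ, ‖FT g₁ (ξ + r • Pi.single j 1) - FT g₁ ξ‖ ≤ M * |r| := by
    intro r
    have := convex_univ.norm_image_sub_le_of_norm_hasDerivWithin_le (𝕜 := ℝ) (x := 0) (y := r)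
      (C := M) (fun r _ => (hasDerivAt_FT_line g₁ j ξ r).hasDerivWithinAt)
      (fun r _ => by rw [← hg₂]; exact norm_FT_le _ _) (Set.mem_univ _) (Set.mem_univ _)
    simpa using this
  have := (convex_closedBall (0 : ℝ) |s|).norm_image_sub_le_of_norm_hasDerivWithin_le (𝕜 := ℝ)
    (f := fun r : ℝ => FT h (ξ + r • Pi.single j 1) - r • FT g₁ ξ)
    (f' := fun r : ℝ => FT g₁ (ξ + r • Pi.single j 1) - FT g₁ ξ)
    (x := 0) (y := s) (C := M * |s|)
    (fun r _ => by
      have h1 := (hasDerivAt_FT_line h j ξ r).sub ((hasDerivAt_id r).smul_const (FT g₁ ξ))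
      rw [← hg₁, one_smul] at h1
      exact h1.hasDerivWithinAt)
    (fun r hr => (hlip r).trans (mul_le_mul_of_nonneg_left (by simpa using hr) hM))
    (by simp) (by simp)
  rw [← hg₁]
  simpa [sub_right_comm] using this

lemma exists_pD_decay {N : ℕ} {W : (Fin N → ℝ) → ℝ}
    (hW : ∀ x j s, |x j| ≤ |x j + s| → W x ≤ W (x + s • Pi.single j 1))
    (h : SchwartzMap (Fin N → ℝ) ℂ) (hdec : ∀ lam : ℝ, 0 < lam → ∃ C : ℝ, ∀ ξ,
      Real.exp (lam * W ξ) * ‖FT h ξ‖ ≤ C) (j : Fin N) {lam : ℝ} (hlam : 0 < lam) :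
    ∃ C : ℝ, ∀ ξ, Real.exp (lam * W ξ) * ‖pD j (FT h) ξ‖ ≤ C := by
  obtain ⟨C, hC⟩ := hdec (2 * lam) (by positivity)
  obtain ⟨M, hM⟩ := exists_norm_FT_taylor_le h j
  refine ⟨C + C + M, fun ξ => ?_⟩
  set ε := Real.exp (-(lam * W ξ)) with hε
  have hε0 : 0 < ε := Real.exp_pos _
  have hε1 : Real.exp (lam * W ξ) * ε = 1 := by rw [hε, ← Real.exp_add]; simp
  have hbound : ∀ η, W ξ ≤ W η → ‖FT h η‖ ≤ C * ε * ε := by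
    intro η hη
    have h1 : Real.exp (2 * lam * W ξ) * ‖FT h η‖ ≤ C :=
      (mul_le_mul_of_nonneg_right (Real.exp_le_exp.2 (by gcongr)) (norm_nonneg _)).trans (hC η)
    have h2 : Real.exp (2 * lam * W ξ) * (ε * ε) = 1 := by
      rw [hε, ← Real.exp_add, ← Real.exp_add, Real.exp_eq_one_iff]; ring
    calc ‖FT h η‖ = Real.exp (2 * lam * W ξ) * ‖FT h η‖ * (ε * ε) := by
          linear_combination (-‖FT h η‖) * h2
      _ ≤ C * (ε * ε) := by gcongr
      _ = _ := by ring
  obtain ⟨s, hs, hs'⟩ : ∃ s : ℝ, |s| = ε ∧ |ξ j| ≤ |ξ j + s| := by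
    rcases le_total 0 (ξ j) with h0 | h0
    · exact ⟨ε, abs_of_pos hε0, by rw [abs_of_nonneg h0, abs_of_nonneg (by linarith)]; linarith⟩
    · exact ⟨-ε, by rw [abs_neg, abs_of_pos hε0], by
        rw [abs_of_nonpos h0, abs_of_nonpos (by linarith)]; linarith⟩
  have h1 := hbound _ (hW ξ j s hs')
  have h2 := hbound ξ le_rfl
  have h3 := hM ξ s
  set u := FT h (ξ + s • Pi.single j 1)
  set v := FT h ξ
  set w := pD j (FT h) ξ
  have h4 : ε * ‖w‖ ≤ ‖u‖ + ‖v‖ + ‖u - v - s • w‖ := by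
    calc ε * ‖w‖ = ‖s • w‖ := by rw [norm_smul, Real.norm_eq_abs, hs]
      _ = ‖u - v - (u - v - s • w)‖ := by rw [sub_sub_cancel]
      _ ≤ ‖u - v‖ + ‖u - v - s • w‖ := norm_sub_le _ _
      _ ≤ _ := by gcongr; exact norm_sub_le _ _
  rw [hs] at h3
  have h5 : ‖w‖ ≤ (C + C + M) * ε := by
    refine le_of_mul_le_mul_left ?_ hε0
    linarith
  calc _ ≤ Real.exp (lam * W ξ) * ((C + C + M) * ε) := by gcongr
    _ = _ := by linear_combination (C + C + M) * hε1

lemma wSum_le_wSum_add_single {N : ℕ} {ω : Fin N → ℝ → ℝ} (hω : ∀ j, IsWeightFun (ω j))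
    (x : Fin N → ℝ) (j : Fin N) (s : ℝ) (hs : |x j| ≤ |x j + s|) :
    wSum ω x ≤ wSum ω (x + s • Pi.single j 1) := by
  refine Finset.sum_le_sum fun i _ => ?_
  rw [(hω i).eq_abs (x i), (hω i).eq_abs ((x + s • (Pi.single j 1 : Fin N → ℝ)) i)]
  refine (hω i).mono (Set.mem_Ici.2 (abs_nonneg _)) (Set.mem_Ici.2 (abs_nonneg _)) ?_
  rcases eq_or_ne i j with rfl | hij
  · simpa using hs
  · simp [hij]

lemma supNorm_lt_top {N : ℕ} {g : (Fin N → ℝ) → ℂ} {C : ℝ} (hg : ∀ x, ‖g x‖ ≤ C) :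
    supNorm g < ⊤ := by
  refine lt_of_le_of_lt (iSup_le fun x => ?_) (ENNReal.ofReal_lt_top (r := C))
  rw [← enorm_eq_nnnorm, ← ofReal_norm]
  exact ENNReal.ofReal_le_ofReal (hg x)

lemma norm_Dpow {N : ℕ} (α : Fin N → ℕ) (g : (Fin N → ℝ) → ℂ) (x : Fin N → ℝ) :
    ‖Dpow α g x‖ = ‖pDpow α g x‖ := by
  simp [Dpow]

lemma prod_abs_pow_mul_norm_le {N : ℕ} {α β : Fin N → ℕ} {g : (Fin N → ℝ) → ℂ} {r : ℝ}
    (hr : 0 ≤ r) (h : supNorm (monMul β (Dpow α g)) ≤ ENNReal.ofReal r) (x : Fin N → ℝ) :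
    (∏ j, |x j| ^ β j) * ‖pDpow α g x‖ ≤ r := by
  have h1 := (le_iSup (fun x => (‖monMul β (Dpow α g) x‖₊ : ℝ≥0∞)) x).trans h
  rw [← enorm_eq_nnnorm, ← ofReal_norm, ENNReal.ofReal_le_ofReal_iff hr] at h1
  simpa [monMul, norm_Dpow, Finset.abs_prod] using h1

/-- A Schwartz function whose weighted seminorms satisfy the two families of
Young-conjugate bounds belongs to `S_Ω^Σ` (Lemma 2.13 of the paper). -/
theorem statement_6 (N : ℕ) (ω σ : Fin N → ℝ → ℝ)
    (hω : ∀ j, IsWeightFun (ω j)) (hσ : ∀ j, IsWeightFun (σ j))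
    (f : SchwartzMap ((Fin N → ℝ)) ℂ)
    (ha : ∀ lam : ℝ, 0 < lam → ∀ β : Fin N → ℕ, ∃ C : ℝ, 0 < C ∧
      ∀ α : Fin N → ℕ,
        supNorm (monMul β (Dpow α (⇑f))) ≤
          ENNReal.ofReal (C * Real.exp (lam * starSum σ (fun j => (α j : ℝ) / lam))))
    (hb : ∀ mu : ℝ, 0 < mu → ∀ α : Fin N → ℕ, ∃ C : ℝ, 0 < C ∧
      ∀ β : Fin N → ℕ,
        supNorm (monMul β (Dpow α (⇑f))) ≤
          ENNReal.ofReal (C * Real.exp (mu * starSum ω (fun j => (β j : ℝ) / mu)))) :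
    MemS (wSum ω) (wSum σ) (⇑f) := by
  have hexp : ∀ (W : (Fin N → ℝ) → ℝ) (lam : ℝ) (α : Fin N → ℕ) (g : (Fin N → ℝ) → ℂ) (C : ℝ),
      (∀ x, Real.exp (lam * W x) * ‖pDpow α g x‖ ≤ C) →
        supNorm (fun x => (Real.exp (lam * W x) : ℂ) * Dpow α g x) < ⊤ := by
    intro W lam α g C hC
    refine supNorm_lt_top (C := C) fun x => ?_
    rw [norm_mul, norm_Dpow, Complex.norm_real, Real.norm_eq_abs, Real.abs_exp]
    exact hC x
  have hdec : ∀ lam : ℝ, 0 < lam → ∃ C : ℝ, ∀ ξ,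
      Real.exp (lam * wSum σ ξ) * ‖FT f ξ‖ ≤ C := by
    intro lam hlam
    refine exists_exp_wSum_mul_norm_le hσ (fun mu hmu => ?_) hlam
    choose C hC0 hC using fun S : Finset (Fin N) => ha mu hmu fun j => if j ∈ S then 2 else 0
    refine ⟨(∫ x : Fin N → ℝ, ∏ j, (1 + x j ^ 2)⁻¹) *
      ∑ S ∈ (Finset.univ : Finset (Fin N)).powerset, C S, fun β ξ => ?_⟩
    rw [norm_FT_pDpow, mul_assoc]
    refine (norm_FT_le _ _).trans (integral_norm_le_of_prod_one_add_sq_mul_le fun x => ?_)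
    rw [Finset.prod_one_add, Finset.sum_mul, Finset.sum_mul]
    refine Finset.sum_le_sum fun S _ => ?_
    have := prod_abs_pow_mul_norm_le (by have := hC0 S; positivity) (hC S β) x
    simpa [pow_ite, Finset.prod_ite_mem] using this
  refine ⟨f.integrable, f.smooth _, contDiff_FT f, fun lam hlam α => ?_, fun lam hlam α => ?_⟩
  · obtain ⟨C, hC⟩ := exists_exp_wSum_mul_norm_le hω (g := pDpow α f) (fun mu hmu => by
      obtain ⟨C, hC0, hC⟩ := hb mu hmu α
      exact ⟨C, fun β => prod_abs_pow_mul_norm_le (by positivity) (hC β)⟩) hlam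
    exact hexp _ _ _ _ C hC
  · have := pDpow_induction (P := fun g => (∃ h : SchwartzMap (Fin N → ℝ) ℂ, FT h = g) ∧
      ∀ lam : ℝ, 0 < lam → ∃ C : ℝ, ∀ ξ, Real.exp (lam * wSum σ ξ) * ‖g ξ‖ ≤ C) (by
        rintro j _ ⟨⟨h, rfl⟩, hd⟩
        exact ⟨exists_FT_eq_pD_FT h j, fun lam hlam =>
          exists_pD_decay (wSum_le_wSum_add_single hσ) h hd j hlam⟩) α ⟨⟨f, rfl⟩, hdec⟩
    obtain ⟨C, hC⟩ := this.2 lam hlam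
    exact hexp _ _ _ _ C hC

end
end
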